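/- Let n ≥ 2 and let B be a skew-symmetrizable n×n integer matrix of type C_n. Let cv denote the set of c-vectors of the cluster algebra with principal coefficients and initial exchange matrix B, and let cv⁺ denote the subset of positive c-vectors. Then cv = cv⁺ ∪ (−cv⁺) (in particular 0 is not a c-vector), and cv⁺ has exactly n² elements. -/

import Mathlib

open MvPolynomial Matrix

noncomputable section

/-- Fomin–Zelevinsky matrix mutation in direction `k`. -/
def mutMat {n : ℕ} (k : Fin n) (B : Matrix (Fin n) (Fin n) ℤ) :
    Matrix (Fin n) (Fin n) ℤ := fun i j =>
  if i = k ∨ j = k then -B i j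
  else B i j + (B i k).sign * max (B i k * B k j) 0

/-- `B` is skew-symmetrizable: `D * B` is skew-symmetric for some diagonal `D`
with positive integer diagonal entries. -/
def SkewSymmetrizable {n : ℕ} (B : Matrix (Fin n) (Fin n) ℤ) : Prop :=
  ∃ d : Fin n → ℤ, (∀ i, 0 < d i) ∧
    (Matrix.diagonal d * B)ᵀ = -(Matrix.diagonal d * B)

/-- The Cartan counterpart `A(B)` of `B`. -/
def cartanCounterpart {n : ℕ} (B : Matrix (Fin n) (Fin n) ℤ) :
    Matrix (Fin n) (Fin n) ℤ := fun i j => if i = j then 2 else -|B i j|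

/-- The Cartan matrix of type `C_n` (with rows and columns indexed by
`0, …, n-1`): `2` on the diagonal, `-2` in position `(n-2, n-1)`, and `-1`
in the remaining positions `(i, i±1)`. -/
def cartanC (n : ℕ) : Matrix (Fin n) (Fin n) ℤ := fun i j =>
  if i = j then 2
  else if i.val + 2 = n ∧ j.val + 1 = n then -2
  else if i.val + 1 = j.val ∨ j.val + 1 = i.val then -1 else 0

/-- The matrix `B` is of type `C_n`: some matrix obtained from `B` by a finite
sequence of mutations has Cartan counterpart equal, up to simultaneous
permutation of rows and columns, to the Cartan matrix of type `C_n`. -/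
def MatrixOfTypeC {n : ℕ} (B : Matrix (Fin n) (Fin n) ℤ) : Prop :=
  ∃ B', Relation.ReflTransGen (fun a c => ∃ k, c = mutMat k a) B B' ∧
    ∃ σ : Equiv.Perm (Fin n),
      ∀ i j, cartanCounterpart B' (σ i) (σ j) = cartanC n i j

/-- Mutation in direction `k` of a `2n × n` integer matrix (rows indexed by
`Fin n ⊕ Fin n`, the first block being the principal part). -/
def mutMatExt {n : ℕ} (k : Fin n) (b : Matrix (Fin n ⊕ Fin n) (Fin n) ℤ) :
    Matrix (Fin n ⊕ Fin n) (Fin n) ℤ := fun i j =>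
  if i = Sum.inl k ∨ j = k then -b i j
  else b i j + (b i k).sign * max (b i k * b (Sum.inl k) j) 0

/-- The `2n × n` matrix `B̃` with top part `B` and bottom part the identity. -/
def extMat {n : ℕ} (B : Matrix (Fin n) (Fin n) ℤ) :
    Matrix (Fin n ⊕ Fin n) (Fin n) ℤ := fun i j =>
  Sum.elim (fun i' => B i' j) (fun i' => if i' = j then 1 else 0) i

/-- The `2n × n` exchange matrices of the principal-coefficients pattern with
initial matrix `B`: all matrices obtained from `B̃` by finite sequences of
mutations. -/
def IsExtMat {n : ℕ} (B : Matrix (Fin n) (Fin n) ℤ)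
    (b : Matrix (Fin n ⊕ Fin n) (Fin n) ℤ) : Prop :=
  Relation.ReflTransGen (fun a c => ∃ k, c = mutMatExt k a) (extMat B) b

/-- `c` is a `c`-vector of the cluster algebra with principal coefficients and
initial exchange matrix `B`: a column of the bottom part of some exchange
matrix of the pattern. -/
def IsCVec {n : ℕ} (B : Matrix (Fin n) (Fin n) ℤ) (c : Fin n → ℤ) : Prop :=
  ∃ b, IsExtMat B b ∧ ∃ j, c = fun i => b (Sum.inr i) j


/-- Combinatorial model: a centrally symmetric triangulation of the `2(n+1)`-gon, encoded as a
labelled binary tree of integer intervals `[a j, c j]` split at `b j`. -/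
structure Tri (n : ℕ) where
  r : Fin n
  par : Fin n → Fin n
  side : Fin n → Bool
  a : Fin n → ℤ
  b : Fin n → ℤ
  c : Fin n → ℤ
  hab : ∀ j, a j < b j
  hbc : ∀ j, b j < c j
  win : ∀ j, a r ≤ a j ∧ c j ≤ c r
  root : c r = a r + (n + 1)
  lft : ∀ j, j ≠ r → side j = false → a j = a (par j) ∧ c j = b (par j)
  rgt : ∀ j, j ≠ r → side j = true → a j = b (par j) ∧ c j = c (par j)
  lam : ∀ i j, i ≠ j → c i ≤ a j ∨ c j ≤ a i ∨ (a j ≤ a i ∧ c i ≤ b j) ∨ (b j ≤ a i ∧ c i ≤ c j)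
    ∨ (a i ≤ a j ∧ c j ≤ b i) ∨ (b i ≤ a j ∧ c j ≤ c i)

/-- the exchange matrix of a triangulation -/
def Bm {n : ℕ} (T : Tri n) : Matrix (Fin n) (Fin n) ℤ := fun i j =>
  if i ≠ T.r ∧ T.par i = j then (if T.side i = true then 1 else -1) * (if j = T.r then 2 else 1)
  else if j ≠ T.r ∧ T.par j = i then (if T.side j = true then -1 else 1)
  else if i ≠ T.r ∧ j ≠ T.r ∧ i ≠ j ∧ T.par i = T.par j then (if T.side i = true then -1 else 1)
  else 0

/-- `T'` is obtained from `T` by flipping the left child `k`. -/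
structure LF {n : ℕ} (k : Fin n) (T T' : Tri n) : Prop where
  hr : T'.r = T.r
  hk : k ≠ T.r
  sk : T.side k = false
  sk' : T'.side k = true
  pk : T'.par k = T.par k
  p1 : ∀ j, j ≠ k → j ≠ T.r → T.par j = k → T.side j = false →
    T'.par j = T.par k ∧ T'.side j = false
  p2 : ∀ j, j ≠ k → j ≠ T.r → T.par j = k → T.side j = true →
    T'.par j = k ∧ T'.side j = false
  p3 : ∀ j, j ≠ k → j ≠ T.r → T.par j = T.par k → T'.par j = k ∧ T'.side j = true
  p4 : ∀ j, j ≠ k → j ≠ T.r → T.par j ≠ k → T.par j ≠ T.par k →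
    T'.par j = T.par j ∧ T'.side j = T.side j
  ak : T'.a k = T.b k
  bk : T'.b k = T.b (T.par k)
  ck : T'.c k = T.c (T.par k)
  by' : T'.b (T.par k) = T.b k
  aj : ∀ j, j ≠ k → T'.a j = T.a j
  bj : ∀ j, j ≠ k → j ≠ T.par k → T'.b j = T.b j
  cj : ∀ j, j ≠ k → T'.c j = T.c j

/-- `T'` is obtained from `T` by flipping the root. -/
structure RootF {n : ℕ} (T T' : Tri n) : Prop where
  hr : T'.r = T.r
  pj : ∀ j, T'.par j = T.par j
  s1 : ∀ j, j ≠ T.r → T.par j = T.r → T'.side j = !T.side j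
  s2 : ∀ j, j ≠ T.r → T.par j ≠ T.r → T'.side j = T.side j
  ar : T'.a T.r = T.b T.r
  br : T'.b T.r = T.a T.r + (n + 1)
  cr : T'.c T.r = T.b T.r + (n + 1)
  sh : ∀ j, j ≠ T.r → (T.c j ≤ T.b T.r ∧ T'.a j = T.a j + (n+1) ∧ T'.b j = T.b j + (n+1) ∧
      T'.c j = T.c j + (n+1)) ∨ (T.b T.r ≤ T.a j ∧ T'.a j = T.a j ∧ T'.b j = T.b j ∧ T'.c j = T.c j)

namespace Tri
variable {n : ℕ} (T : Tri n)

lemma par_ne {j : Fin n} (h : j ≠ T.r) : T.par j ≠ j := by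
  intro h2
  have h3 := T.lft j h; have h4 := T.rgt j h; have := T.hab j; have := T.hbc j
  rw [h2] at h3 h4
  rcases hs : T.side j
  · have := h3 hs; omega
  · have := h4 hs; omega

lemma par_par {j : Fin n} (h : j ≠ T.r) (h' : T.par j ≠ T.r) : T.par (T.par j) ≠ j := by
  intro h2
  have h3 := T.lft j h; have h4 := T.rgt j h; have := T.hab j; have := T.hbc j
  have h5 := T.lft _ h'; have h6 := T.rgt _ h'; have := T.hab (T.par j); have := T.hbc (T.par j)
  rw [h2] at h5 h6
  rcases hs : T.side j <;> rcases hs' : T.side (T.par j)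
  · have := h3 hs; have := h5 hs'; omega
  · have := h3 hs; have := h6 hs'; omega
  · have := h4 hs; have := h5 hs'; omega
  · have := h4 hs; have := h6 hs'; omega

lemma inj_ac {i j : Fin n} (h1 : T.a i = T.a j) (h2 : T.c i = T.c j) : i = j := by
  by_contra h
  have := T.lam i j h; have := T.hab i; have := T.hbc i; have := T.hab j; have := T.hbc j
  omega

lemma inj_b {i j : Fin n} (h1 : T.b i = T.b j) : i = j := by
  by_contra h
  have := T.lam i j h; have := T.hab i; have := T.hbc i; have := T.hab j; have := T.hbc j
  omega

lemma inj_ps {i j : Fin n} (hi : i ≠ T.r) (hj : j ≠ T.r) (h1 : T.par i = T.par j)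
    (h2 : T.side i = T.side j) : i = j := by
  rcases hs : T.side i
  · have h3 := T.lft i hi hs; have h4 := T.lft j hj (h2 ▸ hs)
    rw [h1] at h3
    exact T.inj_ac (by omega) (by omega)
  · have h3 := T.rgt i hi hs; have h4 := T.rgt j hj (h2 ▸ hs)
    rw [h1] at h3
    exact T.inj_ac (by omega) (by omega)

lemma half (j : Fin n) (h : j ≠ T.r) : (T.c j ≤ T.b T.r) ∨ (T.b T.r ≤ T.a j) := by
  have := T.lam j T.r h; have := T.hab j; have := T.hbc j
  have := T.hab T.r; have := T.hbc T.r; have := T.win j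
  omega

end Tri

lemma LF_exists {n : ℕ} (T : Tri n) (k : Fin n) (hk : k ≠ T.r) (hs : T.side k = false) :
    ∃ T', LF k T T' := by
  have hpk := T.par_ne hk
  have hl := T.lft k hk hs
  refine ⟨⟨T.r, fun j => if j = k then T.par k else if j = T.r then T.r else
      if T.par j = k then (if T.side j = true then k else T.par k) else
      if T.par j = T.par k then k else T.par j,
    fun j => if j = k then true else if j = T.r then false else
      if T.par j = k then false else if T.par j = T.par k then true else T.side j,
    fun j => if j = k then T.b k else T.a j,
    fun j => if j = k then T.b (T.par k) else if j = T.par k then T.b k else T.b j,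
    fun j => if j = k then T.c (T.par k) else T.c j, ?_, ?_, ?_, ?_, ?_, ?_, ?_⟩, ?_⟩
  · intro j
    have := T.hab j; have := T.hab k; have := T.hbc k; have := T.hab (T.par k)
    have := T.hbc (T.par k)
    grind
  · intro j
    have := T.hbc j; have := T.hab k; have := T.hbc k; have := T.hab (T.par k)
    have := T.hbc (T.par k)
    grind
  · intro j
    have := T.win j; have := T.win k; have := T.win (T.par k); have := T.hab k; have := T.hbc k
    grind
  · have := T.root
    grind
  · intro j hj
    have h1 := T.lft j hj; have h2 := T.rgt j hj
    have h3 := fun h => T.inj_ps (i := j) (j := k) hj hk h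
    have := T.par_par hk; have := T.par_ne hj
    grind
  · intro j hj
    have h1 := T.lft j hj; have h2 := T.rgt j hj
    have h3 := fun h => T.inj_ps (i := j) (j := k) hj hk h
    have := T.par_par hk; have := T.par_ne hj
    grind
  · intro i j hij
    have h1 := T.lam i j hij
    have h2 := T.lam i k; have h3 := T.lam j k; have h4 := T.lam i (T.par k)
    have h5 := T.lam j (T.par k)
    have := T.hab k; have := T.hbc k; have := T.hab (T.par k)
    have := T.hbc (T.par k); have := T.hab i; have := T.hbc i; have := T.hab j; have := T.hbc j
    by_cases hik : i = k
    · subst hik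
      by_cases hjy : j = T.par i
      · subst hjy
        simp [hpk] <;> omega
      · have := h3 (Ne.symm hij); have := h5 hjy
        simp [hjy, Ne.symm hij]; omega
    · by_cases hjk : j = k
      · subst hjk
        by_cases hjy : i = T.par j
        · subst hjy
          simp [hpk] <;> omega
        · have := h2 hij; have := h4 hjy
          simp [hjy, hij]; omega
      · have := h2 hik; have := h3 hjk
        by_cases hjy : i = T.par k
        · subst hjy
          have := h5 (Ne.symm hij)
          simp [hjk, hpk, Ne.symm hij]; omega
        · have := h4 hjy
          by_cases hjy' : j = T.par k
          · subst hjy'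
            simp [hik, hpk, hij]; omega
          · simp [hik, hjk, hjy, hjy']; omega
  · constructor <;> first | grind | (intro j; grind)


lemma RF_exists {n : ℕ} (T : Tri n) (k : Fin n) (hk : k ≠ T.r) (hs : T.side k = true) :
    ∃ T', LF k T' T := by
  have hpk := T.par_ne hk
  have hl := T.rgt k hk hs
  refine ⟨⟨T.r, fun j => if j = k then T.par k else if j = T.r then T.r else
      if T.par j = k then (if T.side j = true then T.par k else k) else
      if T.par j = T.par k then k else T.par j,
    fun j => if j = k then false else if j = T.r then false else
      if T.par j = k then true else if T.par j = T.par k then false else T.side j,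
    fun j => if j = k then T.a (T.par k) else T.a j,
    fun j => if j = k then T.b (T.par k) else if j = T.par k then T.b k else T.b j,
    fun j => if j = k then T.b k else T.c j, ?_, ?_, ?_, ?_, ?_, ?_, ?_⟩, ?_⟩
  · intro j
    have := T.hab j; have := T.hab k; have := T.hbc k; have := T.hab (T.par k)
    have := T.hbc (T.par k)
    grind
  · intro j
    have := T.hbc j; have := T.hab k; have := T.hbc k; have := T.hab (T.par k)
    have := T.hbc (T.par k)
    grind
  · intro j
    have := T.win j; have := T.win k; have := T.win (T.par k); have := T.hab k; have := T.hbc k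
    grind
  · have := T.root
    grind
  · intro j hj
    have h1 := T.lft j hj; have h2 := T.rgt j hj
    have h3 := fun h => T.inj_ps (i := j) (j := k) hj hk h
    have := T.par_par hk; have := T.par_ne hj
    grind
  · intro j hj
    have h1 := T.lft j hj; have h2 := T.rgt j hj
    have h3 := fun h => T.inj_ps (i := j) (j := k) hj hk h
    have := T.par_par hk; have := T.par_ne hj
    grind
  · intro i j hij
    have h1 := T.lam i j hij
    have h2 := T.lam i k; have h3 := T.lam j k; have h4 := T.lam i (T.par k)
    have h5 := T.lam j (T.par k)
    have := T.hab k; have := T.hbc k; have := T.hab (T.par k)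
    have := T.hbc (T.par k); have := T.hab i; have := T.hbc i; have := T.hab j; have := T.hbc j
    by_cases hik : i = k
    · subst hik
      by_cases hjy : j = T.par i
      · subst hjy
        simp [hpk]
      · have := h3 (Ne.symm hij); have := h5 hjy
        simp [hjy, Ne.symm hij]; omega
    · by_cases hjk : j = k
      · subst hjk
        by_cases hjy : i = T.par j
        · subst hjy
          simp [hpk]
        · have := h2 hij; have := h4 hjy
          simp [hjy, hij]; omega
      · have := h2 hik; have := h3 hjk
        by_cases hjy : i = T.par k
        · subst hjy
          have := h5 (Ne.symm hij)
          simp [hjk, hpk, Ne.symm hij]; omega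
        · have := h4 hjy
          by_cases hjy' : j = T.par k
          · subst hjy'
            simp [hik, hpk, hij]; omega
          · simp [hik, hjk, hjy, hjy']; omega
  · have h3 := fun j hj h => T.inj_ps (i := j) (j := k) hj hk h
    constructor <;> first | grind | (intro j; grind)

lemma RootF_exists {n : ℕ} (T : Tri n) : ∃ T', RootF T T' := by
  have hroot := T.root
  have hwr := T.hab T.r
  have hwr' := T.hbc T.r
  refine ⟨⟨T.r, T.par, fun j => if T.par j = T.r then !T.side j else T.side j,
    fun j => if j = T.r then T.b T.r else if T.c j ≤ T.b T.r then T.a j + (n+1) else T.a j,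
    fun j => if j = T.r then T.a T.r + (n+1) else
      if T.c j ≤ T.b T.r then T.b j + (n+1) else T.b j,
    fun j => if j = T.r then T.b T.r + (n+1) else
      if T.c j ≤ T.b T.r then T.c j + (n+1) else T.c j, ?_, ?_, ?_, ?_, ?_, ?_, ?_⟩, ?_⟩
  · intro j
    have := T.hab j
    grind
  · intro j
    have := T.hbc j
    grind
  · intro j
    have := T.win j
    have := T.half j; have := T.hab j; have := T.hbc j
    grind
  · grind
  · intro j hj
    have h1 := T.lft j hj; have h2 := T.rgt j hj; have := T.half j hj; have := T.half (T.par j)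
    have := T.hab j; have := T.hbc j
    have := T.hab (T.par j); have := T.hbc (T.par j)
    grind
  · intro j hj
    have h1 := T.lft j hj; have h2 := T.rgt j hj; have := T.half j hj; have := T.half (T.par j)
    have := T.hab j; have := T.hbc j
    have := T.hab (T.par j); have := T.hbc (T.par j)
    grind
  · intro i j hij
    have h1 := T.lam i j hij
    have h2 := T.half i; have h3 := T.half j
    have := T.hab i; have := T.hbc i; have := T.hab j; have := T.hbc j
    have := T.win i; have := T.win j
    by_cases hi : i = T.r
    · subst hi
      have := h3 (Ne.symm hij)
      simp only [if_neg (Ne.symm hij), if_true]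
      split_ifs <;> omega
    · by_cases hj : j = T.r
      · subst hj
        have := h2 hij
        simp only [if_neg hij, if_true]
        split_ifs <;> omega
      · have := h2 hi; have := h3 hj
        simp only [if_neg hi, if_neg hj]
        split_ifs <;> omega
  · have := T.half
    constructor <;> first | grind | (intro j; grind)

lemma mutMat_invol {n : ℕ} (k : Fin n) (B : Matrix (Fin n) (Fin n) ℤ) :
    mutMat k (mutMat k B) = B := by
  funext i j
  by_cases hi : i = k
  · simp [mutMat, hi]
  · by_cases hj : j = k
    · simp [mutMat, hj]
    · simp [mutMat, hi, hj]

lemma mutMatExt_invol {n : ℕ} (k : Fin n) (B : Matrix (Fin n ⊕ Fin n) (Fin n) ℤ) :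
    mutMatExt k (mutMatExt k B) = B := by
  funext i j
  by_cases hi : i = Sum.inl k
  · simp [mutMatExt, hi]
  · by_cases hj : j = k
    · simp [mutMatExt, hj]
    · simp [mutMatExt, hi, hj]

lemma RootF_B {n : ℕ} {T T' : Tri n} (h : RootF T T') : Bm T' = mutMat T.r (Bm T) := by
  funext i j
  have hi := T.par_ne (j := i); have hj := T.par_ne (j := j)
  have := T.par_par (j := i); have := T.par_par (j := j)
  have h3 := T.inj_ps (i := i) (j := j)
  have h1i := h.s1 i; have h1j := h.s1 j; have h2i := h.s2 i; have h2j := h.s2 j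
  simp only [mutMat, Bm, h.hr, h.pj]
  by_cases e1 : i = T.r
  · subst e1
    simp only [true_or, if_true, ne_eq, not_true_eq_false, false_and, if_false]
    grind
  · by_cases e2 : j = T.r
    · subst e2
      simp only [or_true, if_true, ne_eq, not_true_eq_false, false_and, if_false]
      grind
    · by_cases e3 : T.par i = T.r <;> by_cases e4 : T.par j = T.r <;>
        cases hs : T.side i <;> cases hs' : T.side j <;> simp_all <;> grind


lemma Tri.par_len {n : ℕ} (T : Tri n) {j : Fin n} (h : j ≠ T.r) :
    T.c j - T.a j < T.c (T.par j) - T.a (T.par j) := by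
  have := T.hab (T.par j); have := T.hbc (T.par j)
  rcases hs : T.side j
  · have := T.lft j h hs; omega
  · have := T.rgt j h hs; omega

lemma Tri.par3 {n : ℕ} (T : Tri n) {i : Fin n} (h1 : i ≠ T.r) (h2 : T.par i ≠ T.r)
    (h3 : T.par (T.par i) ≠ T.r) : T.par (T.par (T.par i)) ≠ i := by
  intro h
  have e1 := T.par_len h1; have e2 := T.par_len h2; have e3 := T.par_len h3
  rw [h] at e3; omega

lemma LF_B {n : ℕ} {k : Fin n} {T T' : Tri n} (h : LF k T T') : Bm T' = mutMat k (Bm T) := by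
  have hk := h.hk
  have sk := h.sk
  have yk := T.par_ne hk
  have ppk := T.par_par hk
  have hcol : ∀ i, i ≠ k → Bm T i k = if i ≠ T.r ∧ T.par i = k then
      (if T.side i = true then 1 else -1) else if i = T.par k then 1 else
      if i ≠ T.r ∧ T.par i = T.par k then -1 else 0 := by
    intro i hi
    have h3 := T.inj_ps (i := i) (j := k)
    simp only [Bm]
    grind
  have hrow : ∀ j, j ≠ k → Bm T k j = if j = T.par k then (if T.par k = T.r then -2 else -1) else
      if j ≠ T.r ∧ T.par j = k then (if T.side j = true then -1 else 1) else
      if j ≠ T.r ∧ T.par j = T.par k then 1 else 0 := by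
    intro j hj
    simp only [Bm]
    grind
  have hS : ∀ i, i ≠ T.r → T.par i = T.par k → i ≠ k → T.side i = true := by
    intro i hi h1 h2
    have h3 := T.inj_ps (i := i) (j := k)
    grind
  funext i j
  have hi := T.par_ne (j := i); have hj := T.par_ne (j := j)
  have h3 := T.inj_ps (i := i) (j := j)
  have p1i := h.p1 i; have p1j := h.p1 j; have p2i := h.p2 i; have p2j := h.p2 j
  have p3i := h.p3 i; have p3j := h.p3 j; have p4i := h.p4 i; have p4j := h.p4 j
  have pk := h.pk; have sk' := h.sk'; have hr := h.hr
  have hSi := hS i; have hSj := hS j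
  by_cases e1 : i = k
  · subst e1
    by_cases e2 : j = i
    · subst e2
      simp only [mutMat, Bm]
      grind
    · have : mutMat i (Bm T) i j = - Bm T i j := by simp [mutMat]
      rw [this, hrow j e2]
      simp only [Bm]
      grind
  · by_cases e2 : j = k
    · subst e2
      have : mutMat j (Bm T) i j = - Bm T i j := by simp [mutMat]
      rw [this, hcol i e1]
      simp only [Bm]
      grind
    · have : mutMat k (Bm T) i j = Bm T i j + (Bm T i k).sign * max (Bm T i k * Bm T k j) 0 := by
        simp [mutMat, e1, e2]
      rw [this, hcol i e1, hrow j e2]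
      clear this hcol hrow hS
      have ppi := T.par_par (j := i); have ppj := T.par_par (j := j)
      have t3i := T.par3 (i := i); have t3j := T.par3 (i := j)
      have t3k := T.par3 (i := k)
      rw [Bm, Bm, hr]
      by_cases a1 : i = T.r
      · by_cases b1 : j = T.r
        · grind
        · by_cases b2 : T.par j = k
          · cases hsj : T.side j <;> grind
          · by_cases b3 : T.par j = T.par k
            · grind
            · grind
      · by_cases a2 : T.par i = k
        · by_cases b1 : j = T.r
          · cases hsi : T.side i <;> grind
          · by_cases b2 : T.par j = k
            · cases hsj : T.side j <;> cases hsi : T.side i <;> grind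
            · by_cases b3 : T.par j = T.par k
              · cases hsi : T.side i <;> grind
              · cases hsi : T.side i <;> grind
        · by_cases a3 : T.par i = T.par k
          · by_cases b1 : j = T.r
            · grind
            · by_cases b2 : T.par j = k
              · cases hsj : T.side j <;> grind
              · by_cases b3 : T.par j = T.par k
                · grind
                · grind
          · by_cases b1 : j = T.r
            · grind
            · by_cases b2 : T.par j = k
              · cases hsj : T.side j <;> grind
              · by_cases b3 : T.par j = T.par k
                · grind
                · grind


/-- counting function -/
def kap (N p x : ℤ) : ℤ := (x - p - 1) / (2 * N)

lemma kap_spec {N p x : ℤ} (hN : 0 < N) : 2 * N * kap N p x ≤ x - p - 1 ∧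
    x - p - 1 < 2 * N * kap N p x + 2 * N := by
  have h := Int.emod_add_mul_ediv (x - p - 1) (2 * N)
  have h1 := Int.emod_nonneg (x - p - 1) (b := 2 * N) (by omega)
  have h2 := Int.emod_lt_of_pos (x - p - 1) (b := 2 * N) (by omega)
  unfold kap
  omega

lemma kap_eq {N p x : ℤ} (hN : 0 < N) (t : ℤ) (h1 : p + 2 * N * t < x)
    (h2 : x ≤ p + 2 * N * t + 2 * N) : kap N p x = t := by
  obtain ⟨h3, h4⟩ := kap_spec (p := p) (x := x) hN
  have a1 : t < kap N p x + 1 := by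
    by_contra h
    have : 2 * N * (kap N p x + 1) ≤ 2 * N * t := by gcongr; omega
    linarith
  have a2 : kap N p x < t + 1 := by
    by_contra h
    have : 2 * N * (t + 1) ≤ 2 * N * kap N p x := by gcongr; omega
    linarith
  omega

lemma kap_0 {N p x : ℤ} (hN : 0 < N) (h1 : p < x) (h2 : x ≤ p + 2 * N) : kap N p x = 0 :=
  kap_eq hN 0 (by linarith) (by linarith)
lemma kap_1 {N p x : ℤ} (hN : 0 < N) (h1 : p + 2 * N < x) (h2 : x ≤ p + 4 * N) : kap N p x = 1 :=
  kap_eq hN 1 (by linarith) (by linarith)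
lemma kap_m1 {N p x : ℤ} (hN : 0 < N) (h1 : p - 2 * N < x) (h2 : x ≤ p) : kap N p x = -1 :=
  kap_eq hN (-1) (by linarith) (by linarith)

lemma kap_sh {N p x : ℤ} (hN : 0 < N) : kap N p (x + 2 * N) = kap N p x + 1 := by
  obtain ⟨h3, h4⟩ := kap_spec (p := p) (x := x) hN
  exact kap_eq hN _ (by linarith) (by linarith)

lemma kap_shp {N p x : ℤ} (hN : 0 < N) : kap N (p + 2 * N) x = kap N p x - 1 := by
  obtain ⟨h3, h4⟩ := kap_spec (p := p) (x := x) hN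
  exact kap_eq hN _ (by linarith) (by linarith)

lemma kap_add {N p x : ℤ} (s : ℤ) : kap N (p + s) (x + s) = kap N p x := by
  unfold kap; congr 1; ring

lemma kap_mono {N p x y : ℤ} (hN : 0 < N) (h : x ≤ y) : kap N p x ≤ kap N p y :=
  Int.ediv_le_ediv (by omega) (by omega)

lemma kap_ex {N p x y : ℤ} (hN : 0 < N) (h : kap N p x < kap N p y) :
    ∃ t, x ≤ p + 2 * N * t ∧ p + 2 * N * t < y := by
  obtain ⟨h1, h2⟩ := kap_spec (p := p) (x := x) hN
  obtain ⟨h3, h4⟩ := kap_spec (p := p) (x := y) hN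
  refine ⟨kap N p y, ?_, by linarith⟩
  have : 2 * N * (kap N p x + 1) ≤ 2 * N * kap N p y := by gcongr; omega
  linarith

def Jch (N p q a b c d : ℤ) : ℤ :=
  (kap N p b - kap N p a) * (kap N q d - kap N q c) +
  (kap N q b - kap N q a) * (kap N p d - kap N p c)

lemma Jch_nonneg {N p q a b c d : ℤ} (hN : 0 < N) (h1 : a ≤ b) (h2 : c ≤ d) :
    0 ≤ Jch N p q a b c d := by
  have a1 := kap_mono (p := p) hN h1
  have a2 := kap_mono (p := q) hN h1
  have a3 := kap_mono (p := p) hN h2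
  have a4 := kap_mono (p := q) hN h2
  have := mul_nonneg (sub_nonneg.2 a1) (sub_nonneg.2 a4)
  have := mul_nonneg (sub_nonneg.2 a2) (sub_nonneg.2 a3)
  unfold Jch; linarith

lemma Jch_ex {N p q a b c d : ℤ} (hN : 0 < N) (h1 : a ≤ b) (h2 : b ≤ c) (h3 : c ≤ d)
    (h4 : d ≤ a + 2 * N) (hp : p < q) (hq : q < p + 2 * N) (h : Jch N p q a b c d ≠ 0) :
    ∃ t, (a ≤ p + 2 * N * t ∧ p + 2 * N * t < b ∧ c ≤ q + 2 * N * t ∧ q + 2 * N * t < d) ∨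
     (a ≤ q + 2 * N * t ∧ q + 2 * N * t < b ∧ c ≤ p + 2 * N * t + 2 * N ∧
      p + 2 * N * t + 2 * N < d) := by
  have a1 := kap_mono (p := p) hN h1
  have a2 := kap_mono (p := q) hN h1
  have a3 := kap_mono (p := p) hN h3
  have a4 := kap_mono (p := q) hN h3
  unfold Jch at h
  have key : (kap N p a < kap N p b ∧ kap N q c < kap N q d) ∨
      (kap N q a < kap N q b ∧ kap N p c < kap N p d) := by
    by_contra hh
    apply h
    push Not at hh
    rcases eq_or_lt_of_le a1 with e | e
    · rcases eq_or_lt_of_le a2 with e' | e'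
      · rw [e, e']; ring
      · have := hh.2 e'
        have : kap N p d = kap N p c := by omega
        rw [e, this]; ring
    · have := hh.1 e
      have h5 : kap N q d = kap N q c := by omega
      rcases eq_or_lt_of_le a2 with e' | e'
      · rw [e', h5]; ring
      · have := hh.2 e'
        have : kap N p d = kap N p c := by omega
        rw [this, h5]; ring
  rcases key with ⟨k1, k2⟩ | ⟨k1, k2⟩
  · obtain ⟨t, t1, t2⟩ := kap_ex hN k1
    obtain ⟨s, s1, s2⟩ := kap_ex hN k2
    have e1 : s < t + 1 := by
      by_contra hh
      have : 2 * N * (t + 1) ≤ 2 * N * s := by gcongr; omega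
      linarith
    have e2 : t < s + 1 := by
      by_contra hh
      have : 2 * N * (s + 1) ≤ 2 * N * t := by gcongr; omega
      linarith
    have : s = t := by omega
    subst this
    exact ⟨s, Or.inl ⟨t1, t2, s1, s2⟩⟩
  · obtain ⟨t, t1, t2⟩ := kap_ex hN k1
    obtain ⟨s, s1, s2⟩ := kap_ex hN k2
    have e1 : t < s := by
      by_contra hh
      have : 2 * N * s ≤ 2 * N * t := by gcongr; omega
      linarith
    have e2 : s < t + 2 := by
      by_contra hh
      have : 2 * N * (t + 2) ≤ 2 * N * s := by gcongr; omega
      linarith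
    have : s = t + 1 := by omega
    subst this
    exact ⟨t, Or.inr ⟨t1, t2, by linarith, by linarith⟩⟩

/-- crossing form of the arc `i` of `T` -/
def JJ {n : ℕ} (T : Tri n) (i : Fin n) (a b c d : ℤ) : ℤ :=
  Jch (n + 1) (T.a i) (T.c i) a b c d +
    if i = T.r then 0 else Jch (n + 1) (T.a i + (n + 1)) (T.c i + (n + 1)) a b c d

/-- arcs of `T`, lifted to the universal cover -/
def EE {n : ℕ} (T : Tri n) (i : Fin n) (x z : ℤ) : Prop :=
  ∃ t : ℤ, (x = T.a i + t * (n + 1) ∧ z = T.c i + t * (n + 1)) ∨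
    (x = T.c i + t * (n + 1) ∧ z = T.a i + t * (n + 1) + 2 * (n + 1))

section
variable {n : ℕ} (T : Tri n) (i : Fin n)

lemma npos (n : ℕ) : (0 : ℤ) < (n : ℤ) + 1 := by positivity

lemma Tri.len (j : Fin n) : T.a j < T.c j ∧ T.c j ≤ T.a j + (n + 1) := by
  have := T.hab j; have := T.hbc j; have := T.win j; have := T.root; omega

lemma JJ_add1 (a b c x y : ℤ) : JJ T i a c x y = JJ T i a b x y + JJ T i b c x y := by
  unfold JJ Jch; split_ifs <;> ring

lemma JJ_add2 (a b c x y : ℤ) : JJ T i x y a c = JJ T i x y a b + JJ T i x y b c := by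
  unfold JJ Jch; split_ifs <;> ring

lemma JJ_symm (a b c d : ℤ) : JJ T i a b c d = JJ T i c d a b := by
  unfold JJ Jch; split_ifs <;> ring

lemma JJ_self (a c d : ℤ) : JJ T i a a c d = 0 := by
  unfold JJ Jch; split_ifs <;> ring

lemma JJ_sh (a b c d : ℤ) : JJ T i (a + 2 * (n + 1)) (b + 2 * (n + 1)) c d = JJ T i a b c d := by
  unfold JJ Jch; simp only [kap_sh (npos n)]; split_ifs <;> ring

lemma JJ_shN (a b c d : ℤ) : JJ T i (a + (n + 1)) (b + (n + 1)) (c + (n + 1)) (d + (n + 1))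
    = JJ T i a b c d := by
  have h1 : ∀ p x : ℤ, kap (n + 1) p (x + (n + 1)) = kap (n + 1) (p + (n + 1)) x + 1 := by
    intro p x
    rw [← kap_add (n + 1 : ℤ), ← kap_sh (npos n)]
    congr 1; ring
  unfold JJ Jch
  split_ifs with h
  · have h2 : ∀ x : ℤ, kap (n + 1) (T.c i) x = kap (n + 1) (T.a i + (n + 1)) x := by
      intro x; rw [h, T.root]
    have h3 : ∀ x : ℤ, kap (n + 1) (T.a i + (n + 1) + (n + 1)) x = kap (n + 1) (T.a i) x - 1 := by
      intro x; rw [← kap_shp (npos n)]; congr 1; ring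
    simp only [h2, h1, h3]; ring
  · have h3 : ∀ p x : ℤ, kap (n + 1) (p + (n + 1) + (n + 1)) x = kap (n + 1) p x - 1 := by
      intro p x; rw [← kap_shp (npos n)]; congr 1; ring
    simp only [h1, h3]; ring

lemma JJ_nonneg {a b c d : ℤ} (h1 : a ≤ b) (h2 : c ≤ d) : 0 ≤ JJ T i a b c d := by
  have := Jch_nonneg (p := T.a i) (q := T.c i) (npos n) h1 h2
  have := Jch_nonneg (p := T.a i + (n + 1)) (q := T.c i + (n + 1)) (npos n) h1 h2
  unfold JJ; split_ifs <;> omega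

lemma JJ_ex {a b c d : ℤ} (h1 : a ≤ b) (h2 : b ≤ c) (h3 : c ≤ d)
    (h4 : d ≤ a + 2 * (n + 1)) (h : JJ T i a b c d ≠ 0) :
    ∃ x y, a ≤ x ∧ x < b ∧ c ≤ y ∧ y < d ∧ EE T i x y := by
  have hl := T.len i
  have hnp := npos n
  unfold JJ at h
  have : Jch (n + 1) (T.a i) (T.c i) a b c d ≠ 0 ∨
      Jch (n + 1) (T.a i + (n + 1)) (T.c i + (n + 1)) a b c d ≠ 0 := by
    by_contra hh; push Not at hh; rw [hh.1, hh.2] at h; simp at h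
  rcases this with h | h
  · obtain ⟨t, ⟨e1, e2, e3, e4⟩ | ⟨e1, e2, e3, e4⟩⟩ := Jch_ex (npos n) h1 h2 h3 h4
      (by omega) (by omega) h
    · exact ⟨_, _, e1, e2, e3, e4, 2 * t, Or.inl ⟨by ring, by ring⟩⟩
    · exact ⟨_, _, e1, e2, e3, e4, 2 * t, Or.inr ⟨by ring, by ring⟩⟩
  · obtain ⟨t, ⟨e1, e2, e3, e4⟩ | ⟨e1, e2, e3, e4⟩⟩ := Jch_ex (npos n) h1 h2 h3 h4
      (by omega) (by omega) h
    · exact ⟨_, _, e1, e2, e3, e4, 2 * t + 1, Or.inl ⟨by ring, by ring⟩⟩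
    · exact ⟨_, _, e1, e2, e3, e4, 2 * t + 1, Or.inr ⟨by ring, by ring⟩⟩

lemma EE_nc {i j : Fin n} {x y z w : ℤ} (h1 : EE T i x z) (h2 : EE T j y w) (l1 : x < y)
    (l2 : y < z) (l3 : z < w) (l4 : w < x + 2 * (n + 1)) : False := by
  obtain ⟨t, h1⟩ := h1
  obtain ⟨s, h2⟩ := h2
  have hnp := npos n
  have ht : ∀ τ k : ℤ, τ * (n + 1) < k * (n + 1) → τ < k := fun τ k h =>
    lt_of_mul_lt_mul_right h hnp.le
  obtain ⟨τ, rfl⟩ : ∃ τ, s = t + τ := ⟨s - t, by ring⟩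
  have hi := T.len i; have hj := T.len j; have wi := T.win i; have wj := T.win j
  have hro := T.root
  have lam : i = j ∨ _ := (em (i = j)).imp_right (T.lam i j)
  have := T.hab i; have := T.hbc i; have := T.hab j; have := T.hbc j
  rw [add_mul] at h2
  rcases h1 with ⟨rfl, rfl⟩ | ⟨rfl, rfl⟩ <;> rcases h2 with ⟨rfl, rfl⟩ | ⟨rfl, rfl⟩
  · have e1 := ht τ 1 (by omega)
    have e2 := ht (-1) τ (by omega)
    have : τ = 0 := by omega
    subst this
    rcases lam with rfl | lam <;> omega
  · have e1 := ht τ 1 (by omega)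
    have e2 := ht (-1) τ (by omega)
    have : τ = 0 := by omega
    subst this
    rcases lam with rfl | lam <;> omega
  · have e1 := ht τ 3 (by omega)
    have e2 := ht 1 τ (by omega)
    have : τ = 2 := by omega
    subst this
    rcases lam with rfl | lam <;> omega
  · have e1 := ht τ 1 (by omega)
    have e2 := ht (-1) τ (by omega)
    have : τ = 0 := by omega
    subst this
    rcases lam with rfl | lam <;> omega

lemma JJ_excl {i j : Fin n} {a b c d : ℤ} (h1 : a ≤ b) (h2 : b ≤ c) (h3 : c ≤ d)
    (h4 : d ≤ a + 2 * (n + 1)) : JJ T i a b c d = 0 ∨ JJ T j b c d (a + 2 * (n + 1)) = 0 := by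
  by_contra hh
  push Not at hh
  obtain ⟨x, z, e1, e2, e3, e4, e5⟩ := JJ_ex T i h1 h2 h3 h4 hh.1
  obtain ⟨y, w, f1, f2, f3, f4, f5⟩ := JJ_ex T j h2 h3 h4 (by omega) hh.2
  exact EE_nc T e5 f5 (by omega) (by omega) (by omega) (by omega)

end


/-- shear coordinate of a quadrilateral with respect to the arc `i` -/
def cvq {n : ℕ} (T : Tri n) (i : Fin n) (a b c d : ℤ) : ℤ :=
  JJ T i a b c d - JJ T i b c d (a + 2 * (n + 1))

/-- fourth vertex of the quadrilateral around `j` -/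
def dd {n : ℕ} (T : Tri n) (j : Fin n) : ℤ :=
  if j = T.r then T.b j + (n + 1) else if T.side j = true then T.a (T.par j) + 2 * (n + 1)
  else T.c (T.par j)

def Cm {n : ℕ} (T0 T : Tri n) (i j : Fin n) : ℤ := cvq T0 i (T.a j) (T.b j) (T.c j) (dd T j)

def extT {n : ℕ} (T0 T : Tri n) : Matrix (Fin n ⊕ Fin n) (Fin n) ℤ :=
  fun i j => Sum.elim (fun i' => Bm T i' j) (fun i' => Cm T0 T i' j) i

section
variable {n : ℕ} (T0 : Tri n) (i : Fin n)

lemma dd_lt (T : Tri n) (j : Fin n) : T.c j < dd T j ∧ dd T j < T.a j + 2 * (n + 1) := by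
  have h1 := T.len j; have h2 := T.root; have h3 := T.hab j; have h4 := T.hbc j
  have h5 := T.win j
  have := T.hab (T.par j); have := T.hbc (T.par j); have := T.win (T.par j)
  unfold dd
  split_ifs with e1 e2
  · subst e1; omega
  · have := T.rgt j e1 e2; omega
  · have := T.lft j e1 (by simpa using e2); omega

lemma JJ_sh2 (a b c d : ℤ) : JJ T0 i a b (c + 2 * (n + 1)) (d + 2 * (n + 1)) = JJ T0 i a b c d := by
  rw [JJ_symm, JJ_sh, JJ_symm]

lemma cvq_shN (a b c d : ℤ) : cvq T0 i (a + (n + 1)) (b + (n + 1)) (c + (n + 1)) (d + (n + 1))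
    = cvq T0 i a b c d := by
  unfold cvq
  rw [JJ_shN, show a + ((n : ℤ) + 1) + 2 * (n + 1) = a + 2 * (n + 1) + (n + 1) by ring, JJ_shN]

lemma cvq_rot (a b c d : ℤ) : cvq T0 i b c d (a + 2 * (n + 1)) = - cvq T0 i a b c d := by
  unfold cvq
  rw [JJ_sh2, JJ_symm T0 i c d a b]
  ring

lemma sgn_max {x y β : ℤ} (hx : 0 ≤ x) (hy : 0 ≤ y) (h : x = 0 ∨ y = 0) :
    (x - y).sign * max ((x - y) * β) 0 = if 0 ≤ β then β * x else β * y := by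
  rcases h with rfl | rfl
  · rcases eq_or_lt_of_le hy with rfl | hy
    · simp
    · rw [Int.sign_eq_neg_one_of_neg (by omega)]
      split_ifs with hb
      · rw [max_eq_right (by nlinarith)]; simp
      · rw [max_eq_left (by nlinarith)]; ring
  · rcases eq_or_lt_of_le hx with rfl | hx
    · simp
    · rw [Int.sign_eq_one_of_pos (by omega)]
      split_ifs with hb
      · rw [max_eq_left (by nlinarith)]; ring
      · rw [max_eq_right (by nlinarith)]; simp

lemma Cm_step (T : Tri n) (k : Fin n) (β : ℤ) :
    (Cm T0 T i k).sign * max (Cm T0 T i k * β) 0 =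
    if 0 ≤ β then β * JJ T0 i (T.a k) (T.b k) (T.c k) (dd T k)
    else β * JJ T0 i (T.b k) (T.c k) (dd T k) (T.a k + 2 * (n + 1)) := by
  have h1 := dd_lt T k; have h2 := T.hab k; have h3 := T.hbc k
  unfold Cm cvq
  exact sgn_max (JJ_nonneg _ _ h2.le h1.1.le) (JJ_nonneg _ _ h3.le h1.2.le)
    (JJ_excl T0 h2.le h3.le h1.1.le h1.2.le)

lemma LF_row {k : Fin n} {T T' : Tri n} (h : LF k T T') (j : Fin n) (hj : j ≠ k) :
    Bm T k j = if j = T.par k then (if T.par k = T.r then -2 else -1) else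
      if j ≠ T.r ∧ T.par j = k then (if T.side j = true then -1 else 1) else
      if j ≠ T.r ∧ T.par j = T.par k then 1 else 0 := by
  have hk := h.hk
  have sk := h.sk
  have yk := T.par_ne hk
  have ppk := T.par_par hk
  simp only [Bm]
  grind

lemma LF_C {k : Fin n} {T T' : Tri n} (h : LF k T T') (j : Fin n) :
    Cm T0 T' i j = if j = k then - Cm T0 T i j else
      Cm T0 T i j + (Cm T0 T i k).sign * max (Cm T0 T i k * Bm T k j) 0 := by
  have hk := h.hk
  have yk := T.par_ne hk
  have hr := h.hr
  have hlk := T.lft k hk h.sk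
  have ddk : dd T k = T.c (T.par k) := by simp [dd, hk, h.sk]
  by_cases e1 : j = k
  · subst e1
    have ddk' : dd T' j = T.a j + 2 * (n + 1) := by
      simp [dd, hr, hk, h.sk', h.pk, h.aj _ yk, hlk.1]
    rw [if_pos rfl]
    unfold Cm
    rw [ddk', ddk, h.ak, h.bk, h.ck, ← hlk.2, cvq_rot]
  rw [if_neg e1]
  have hrow := LF_row h j e1
  have aj := h.aj j e1; have cj := h.cj j e1
  by_cases e2 : j = T.par k
  · rw [if_pos e2] at hrow
    have e2s := e2.symm
    by_cases e3 : j = T.r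
    · have hb : Bm T k j = -2 := by rw [hrow, e2s, if_pos e3]
      rw [hb, Cm_step, ddk, if_neg (by norm_num)]
      have d1 : dd T j = T.c k + (n + 1) := by rw [dd, if_pos e3, hlk.2, e2]
      have d2 : dd T' j = T.b k + (n + 1) := by
        rw [dd, hr, if_pos e3]
        have := h.by'
        rw [← e2] at this; rw [this]
      have c1 : T.c j = T.a k + (n + 1) := by
        rw [hlk.1, ← e2]; rw [e3]; exact T.root
      unfold Cm
      rw [d1, d2, aj, cj, c1, e2s, c1]
      have b1 : T'.b j = T.b k := by have := h.by'; rwa [← e2] at this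
      have b2 : T.b j = T.c k := by rw [e2]; exact hlk.2.symm
      have a1 : T.a j = T.a k := by rw [e2]; exact hlk.1.symm
      rw [b1, b2, a1]
      generalize T.a k = p; generalize T.b k = m; generalize T.c k = q
      have f1 : JJ T0 i p m (m + (n + 1)) (q + (n + 1)) =
          JJ T0 i m q (p + (n + 1)) (m + (n + 1)) := by
        rw [← JJ_shN, ← JJ_sh T0 i m q, JJ_symm]
        congr 1 <;> ring
      have f2 : JJ T0 i q (p + (n + 1)) (m + (n + 1)) (q + (n + 1)) =
          JJ T0 i m q (q + (n + 1)) (p + 2 * (n + 1)) := by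
        rw [← JJ_shN, ← JJ_sh T0 i m q, JJ_symm]
        congr 1 <;> ring
      unfold cvq
      have g1 := JJ_add2 T0 i (p + (n + 1)) (m + (n + 1)) (q + (n + 1)) p q
      have g2 := JJ_add1 T0 i p m q (p + (n + 1)) (m + (n + 1))
      have g3 := JJ_add1 T0 i p m q (m + (n + 1)) (q + (n + 1))
      have g4 := JJ_add1 T0 i m q (p + (n + 1)) (m + (n + 1)) (p + 2 * (n + 1))
      have g5 := JJ_add2 T0 i (m + (n + 1)) (q + (n + 1)) (p + 2 * (n + 1)) q (p + (n + 1))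
      have g6 := JJ_add2 T0 i (p + (n + 1)) (m + (n + 1)) (p + 2 * (n + 1)) m q
      have g7 := JJ_add2 T0 i (m + (n + 1)) (q + (n + 1)) (p + 2 * (n + 1)) m q
      linarith
    · have hb : Bm T k j = -1 := by rw [hrow, e2s, if_neg e3]
      rw [hb, Cm_step, ddk, if_neg (by norm_num)]
      have p4 := h.p4 j e1 e3 (by rw [e2]; exact T.par_par hk (e2 ▸ e3))
        (by rw [← e2]; exact T.par_ne e3)
      have d1 : dd T' j = dd T j := by
        have : T.par j ≠ k := by rw [e2]; exact T.par_par hk (e2 ▸ e3)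
        simp [dd, hr, e3, p4, h.aj _ this, h.cj _ this]
      unfold Cm
      have b1 : T'.b j = T.b k := by have := h.by'; rwa [← e2] at this
      have b2 : T.b j = T.c k := by rw [e2]; exact hlk.2.symm
      have a1 : T.a j = T.a k := by rw [e2]; exact hlk.1.symm
      rw [d1, aj, cj, b1, b2, a1, e2s]
      unfold cvq JJ Jch
      split_ifs <;> ring
  · rw [if_neg e2] at hrow
    have bj := h.bj j e1 e2
    by_cases e3 : j = T.r
    · have d1 : dd T' j = dd T j := by simp only [dd, hr, e3, if_true]; rw [← e3, bj]
      have hb : Bm T k j = 0 := by rw [hrow, if_neg (by tauto), if_neg (by tauto)]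
      rw [hb]
      simp [Cm, d1, aj, bj, cj]
    · by_cases e4 : T.par j = k
      · rw [if_pos ⟨e3, e4⟩] at hrow
        cases hs : T.side j
        · have hb : Bm T k j = 1 := by rw [hrow, hs]; simp
          rw [hb, Cm_step, ddk, if_pos (by norm_num)]
          have hp := h.p1 j e1 e3 e4 hs
          have d1 : dd T j = T.c k := by simp [dd, e3, hs, e4]
          have d2 : dd T' j = T.c (T.par k) := by simp [dd, hr, e3, hp, h.cj _ yk]
          have l := T.lft j e3 hs
          rw [e4] at l
          unfold Cm
          rw [d1, d2, aj, bj, cj, l.1, l.2]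
          unfold cvq JJ Jch
          split_ifs <;> ring
        · have hb : Bm T k j = -1 := by rw [hrow, hs]; simp
          rw [hb, Cm_step, ddk, if_neg (by norm_num)]
          have hp := h.p2 j e1 e3 e4 hs
          have d1 : dd T j = T.a k + 2 * (n + 1) := by simp [dd, e3, hs, e4]
          have d2 : dd T' j = T.c (T.par k) := by simp [dd, hr, e3, hp, h.ck]
          have l := T.rgt j e3 hs
          rw [e4] at l
          unfold Cm
          rw [d1, d2, aj, bj, cj, l.1, l.2]
          unfold cvq JJ Jch
          split_ifs <;> ring
      · rw [if_neg (by tauto)] at hrow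
        by_cases e5 : T.par j = T.par k
        · rw [if_pos ⟨e3, e5⟩] at hrow
          rw [hrow, Cm_step, ddk, if_pos (by norm_num)]
          have hp := h.p3 j e1 e3 e5
          have hs : T.side j = true := by
            by_contra hs
            have := T.inj_ps e3 hk e5 (by simp [h.sk, hs])
            exact e1 this
          have d1 : dd T j = T.a k + 2 * (n + 1) := by simp [dd, e3, hs, e5, hlk.1]
          have d2 : dd T' j = T.b k + 2 * (n + 1) := by simp [dd, hr, e3, hp, h.ak]
          have l := T.rgt j e3 hs
          rw [e5, ← hlk.2] at l
          unfold Cm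
          rw [d1, d2, aj, bj, cj, l.1, l.2]
          unfold cvq JJ Jch
          simp only [kap_sh (npos n)]
          split_ifs <;> ring
        · rw [if_neg (by tauto)] at hrow
          rw [hrow]
          have hp := h.p4 j e1 e3 e4 e5
          have d1 : dd T' j = dd T j := by
            simp [dd, hr, e3, hp, h.aj _ e4, h.cj _ e4]
          simp [Cm, d1, aj, bj, cj]

lemma RootF_C {T T' : Tri n} (h : RootF T T') (j : Fin n) :
    Cm T0 T' i j = if j = T.r then - Cm T0 T i j else
      Cm T0 T i j + (Cm T0 T i T.r).sign * max (Cm T0 T i T.r * Bm T T.r j) 0 := by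
  have hr := h.hr
  have hro := T.root
  have ddk : dd T T.r = T.b T.r + (n + 1) := by simp [dd]
  by_cases e1 : j = T.r
  · subst e1
    rw [if_pos rfl]
    unfold Cm
    have : dd T' T.r = T.a T.r + 2 * (n + 1) := by
      rw [dd, if_pos hr.symm, h.br]; ring
    rw [this, h.ar, h.br, h.cr, ddk, hro, cvq_rot]
  rw [if_neg e1, Cm_step, ddk, hro]
  by_cases e2 : T.par j = T.r
  · have hb : Bm T T.r j = if T.side j = true then -1 else 1 := by
      simp [Bm, e1, e2]
    have h1 := h.s1 j e1 e2
    have sh := h.sh j e1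
    have := T.hab T.r; have := T.hbc T.r; have := T.hab j; have := T.hbc j
    cases hs : T.side j
    · rw [hb, hs, if_pos (by norm_num)]
      have l := T.lft j e1 hs
      rw [e2] at l
      have d1 : dd T j = T.a T.r + (n + 1) := by rw [dd, if_neg e1, if_neg (by simp [hs]), e2, hro]
      have d2 : dd T' j = T.b T.r + (n + 1) + (n + 1) := by
        rw [dd, hr, if_neg e1, h1, hs, h.pj, e2, h.ar]; simp; ring
      have sh' : T'.a j = T.a j + (n+1) ∧ T'.b j = T.b j + (n+1) ∧ T'.c j = T.c j + (n+1) := by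
        omega
      unfold Cm
      rw [d1, d2, sh'.1, sh'.2.1, sh'.2.2, cvq_shN, l.1, l.2]
      unfold cvq JJ Jch
      simp only [Bool.false_eq_true, if_false]
      split_ifs <;> ring
    · rw [hb, hs, if_neg (by norm_num)]
      have l := T.rgt j e1 hs
      rw [e2] at l
      have d1 : dd T j = T.a T.r + 2 * (n + 1) := by rw [dd, if_neg e1, if_pos hs, e2]
      have d2 : dd T' j = T.b T.r + (n + 1) := by
        rw [dd, hr, if_neg e1, h1, hs, h.pj, e2, h.cr]; simp
      have sh' : T'.a j = T.a j ∧ T'.b j = T.b j ∧ T'.c j = T.c j := by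
        omega
      unfold Cm
      rw [d1, d2, sh'.1, sh'.2.1, sh'.2.2, l.1, l.2, hro]
      unfold cvq JJ Jch
      simp only [if_true]
      split_ifs <;> ring
  · have hb : Bm T T.r j = 0 := by simp [Bm, e2]
    rw [hb, if_pos le_rfl, zero_mul, add_zero]
    have h2 := h.s2 j e1 e2
    have sh := h.sh j e1
    have shp := h.sh (T.par j) e2
    have := T.hab (T.par j); have := T.hbc (T.par j); have := T.hab j; have := T.hbc j
    have sub : T.a (T.par j) ≤ T.a j ∧ T.c j ≤ T.c (T.par j) := by
      cases hs : T.side j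
      · have := T.lft j e1 hs; omega
      · have := T.rgt j e1 hs; omega
    by_cases e3 : T.c (T.par j) ≤ T.b T.r
    · have s1 : T'.a j = T.a j + (n+1) ∧ T'.b j = T.b j + (n+1) ∧ T'.c j = T.c j + (n+1) := by
        omega
      have s2 : T'.a (T.par j) = T.a (T.par j) + (n+1) ∧ T'.c (T.par j) = T.c (T.par j) + (n+1) := by
        omega
      have d1 : dd T' j = dd T j + (n + 1) := by
        rw [dd, dd, hr, if_neg e1, if_neg e1, h2, h.pj, s2.1, s2.2]
        split_ifs <;> ring
      unfold Cm
      rw [d1, s1.1, s1.2.1, s1.2.2, cvq_shN]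
    · have s1 : T'.a j = T.a j ∧ T'.b j = T.b j ∧ T'.c j = T.c j := by
        omega
      have s2 : T'.a (T.par j) = T.a (T.par j) ∧ T'.c (T.par j) = T.c (T.par j) := by
        omega
      have d1 : dd T' j = dd T j := by
        rw [dd, dd, hr, if_neg e1, if_neg e1, h2, h.pj, s2.1, s2.2]
      unfold Cm
      rw [d1, s1.1, s1.2.1, s1.2.2]

lemma ext_of {T T' : Tri n} (k : Fin n) (h1 : Bm T' = mutMat k (Bm T))
    (h2 : ∀ i j, Cm T0 T' i j = if j = k then - Cm T0 T i j else
      Cm T0 T i j + (Cm T0 T i k).sign * max (Cm T0 T i k * Bm T k j) 0) :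
    extT T0 T' = mutMatExt k (extT T0 T) := by
  funext i j
  rcases i with i | i
  · simp [extT, mutMatExt, h1, mutMat]
  · simp [extT, mutMatExt, h2]

lemma LF_ext {T T' : Tri n} {k : Fin n} (h : LF k T T') : extT T0 T' = mutMatExt k (extT T0 T) :=
  ext_of T0 k (LF_B h) (fun i j => LF_C T0 i h j)

lemma LF_ext' {T T' : Tri n} {k : Fin n} (h : LF k T T') : extT T0 T = mutMatExt k (extT T0 T') := by
  rw [LF_ext T0 h, mutMatExt_invol]

lemma RootF_ext {T T' : Tri n} (h : RootF T T') : extT T0 T' = mutMatExt T.r (extT T0 T) :=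
  ext_of T0 _ (RootF_B h) (fun i j => RootF_C T0 i h j)

lemma flip_ext (T : Tri n) (k : Fin n) : ∃ T', extT T0 T' = mutMatExt k (extT T0 T) := by
  by_cases hk : k = T.r
  · obtain ⟨T', h⟩ := RootF_exists T
    exact ⟨T', hk ▸ RootF_ext T0 h⟩
  · cases hs : T.side k
    · obtain ⟨T', h⟩ := LF_exists T k hk hs
      exact ⟨T', LF_ext T0 h⟩
    · obtain ⟨T', h⟩ := RF_exists T k hk hs
      exact ⟨T', LF_ext' T0 h⟩

end


section
variable {n : ℕ} (T : Tri n)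

lemma Tri.b_win (j : Fin n) : T.a T.r < T.b j ∧ T.b j < T.a T.r + (n + 1) := by
  have := T.hab j; have := T.hbc j; have := T.win j; have := T.root; omega

lemma Tri.b_surj {x : ℤ} (h1 : T.a T.r < x) (h2 : x < T.a T.r + (n + 1)) : ∃ j, T.b j = x := by
  have hsub : Finset.univ.image T.b ⊆ Finset.Ioo (T.a T.r) (T.a T.r + (n + 1)) := by
    intro y hy
    simp only [Finset.mem_image, Finset.mem_univ, true_and] at hy
    obtain ⟨j, rfl⟩ := hy
    simpa using T.b_win j
  have hc : (Finset.univ.image T.b).card = n := by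
    rw [Finset.card_image_of_injective _ (fun i j h => T.inj_b h)]; simp
  have := Finset.eq_of_subset_of_card_le hsub (by
    rw [hc, Int.card_Ioo]; omega)
  have hx : x ∈ Finset.univ.image T.b := by rw [this]; simp [h1, h2]
  simpa using hx

lemma Tri.compl_left (y : Fin n) : T.b y = T.a y + 1 ∨ ∃ i, T.a i = T.a y ∧ T.c i = T.b y := by
  by_contra hh
  push Not at hh
  obtain ⟨h1, h2⟩ := hh
  have e1 := T.hab y; have e2 := T.hbc y; have e3 := T.win y; have e4 := T.root
  obtain ⟨j, hj⟩ := T.b_surj (x := T.a y + 1) (by omega) (by omega)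
  classical
  let S := Finset.univ.filter (fun i => T.a y ≤ T.a i ∧ T.c i ≤ T.b y)
  have hjy : j ≠ y := by rintro rfl; omega
  have hjS : j ∈ S := by
    have := T.lam j y hjy; have := T.hab j; have := T.hbc j
    simp only [S, Finset.mem_filter, Finset.mem_univ, true_and]
    omega
  obtain ⟨i, hi, hmax⟩ := S.exists_max_image (fun i => T.c i - T.a i) ⟨j, hjS⟩
  simp only [S, Finset.mem_filter, Finset.mem_univ, true_and] at hi hmax
  have f1 := T.hab i; have f2 := T.hbc i
  have hir : i ≠ T.r := by rintro rfl; omega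
  have hpl := T.par_len hir
  have g1 := T.hab (T.par i); have g2 := T.hbc (T.par i)
  have hm := hmax (T.par i)
  have hl := T.lft i hir; have hr := T.rgt i hir
  by_cases hy : T.par i = y
  · rw [hy] at hl hr
    cases hs : T.side i
    · exact h2 i (hl hs).1 (hl hs).2
    · have := hr hs; omega
  · have := T.lam (T.par i) y hy
    cases hs : T.side i
    · have := hl hs; omega
    · have := hr hs; omega

lemma Tri.compl_right (y : Fin n) : T.c y = T.b y + 1 ∨ ∃ i, T.a i = T.b y ∧ T.c i = T.c y := by
  by_contra hh
  push Not at hh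
  obtain ⟨h1, h2⟩ := hh
  have e1 := T.hab y; have e2 := T.hbc y; have e3 := T.win y; have e4 := T.root
  obtain ⟨j, hj⟩ := T.b_surj (x := T.b y + 1) (by omega) (by omega)
  classical
  let S := Finset.univ.filter (fun i => T.b y ≤ T.a i ∧ T.c i ≤ T.c y)
  have hjy : j ≠ y := by rintro rfl; omega
  have hjS : j ∈ S := by
    have := T.lam j y hjy; have := T.hab j; have := T.hbc j
    simp only [S, Finset.mem_filter, Finset.mem_univ, true_and]
    omega
  obtain ⟨i, hi, hmax⟩ := S.exists_max_image (fun i => T.c i - T.a i) ⟨j, hjS⟩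
  simp only [S, Finset.mem_filter, Finset.mem_univ, true_and] at hi hmax
  have f1 := T.hab i; have f2 := T.hbc i
  have hir : i ≠ T.r := by rintro rfl; omega
  have hpl := T.par_len hir
  have g1 := T.hab (T.par i); have g2 := T.hbc (T.par i)
  have hm := hmax (T.par i)
  have hl := T.lft i hir; have hr := T.rgt i hir
  by_cases hy : T.par i = y
  · rw [hy] at hl hr
    cases hs : T.side i
    · have := hl hs; omega
    · exact h2 i (hr hs).1 (hr hs).2
  · have := T.lam (T.par i) y hy
    cases hs : T.side i
    · have := hl hs; omega
    · have := hr hs; omega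

/-- arcs and boundary edges -/
def Ep (x z : ℤ) : Prop := z = x + 1 ∨ ∃ i, EE T i x z

variable {T}
lemma EE_sh {i : Fin n} {x z : ℤ} (s : ℤ) (h : EE T i x z) :
    EE T i (x + s * (n + 1)) (z + s * (n + 1)) := by
  obtain ⟨t, ⟨h1, h2⟩ | ⟨h1, h2⟩⟩ := h
  · exact ⟨t + s, Or.inl ⟨by rw [h1]; ring, by rw [h2]; ring⟩⟩
  · exact ⟨t + s, Or.inr ⟨by rw [h1]; ring, by rw [h2]; ring⟩⟩

lemma EE_rot {i : Fin n} {x z : ℤ} (h : EE T i x z) : EE T i z (x + 2 * (n + 1)) := by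
  obtain ⟨t, ⟨h1, h2⟩ | ⟨h1, h2⟩⟩ := h
  · exact ⟨t, Or.inr ⟨by rw [h2], by rw [h1]⟩⟩
  · exact ⟨t + 2, Or.inl ⟨by rw [h2]; ring, by rw [h1]; ring⟩⟩

lemma EE_ac (T : Tri n) (i : Fin n) : EE T i (T.a i) (T.c i) := ⟨0, Or.inl ⟨by ring, by ring⟩⟩

lemma Ep_sh {x z : ℤ} (s : ℤ) (h : Ep T x z) : Ep T (x + s * (n + 1)) (z + s * (n + 1)) := by
  rcases h with h | ⟨i, h⟩
  · left; rw [h]; ring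
  · exact Or.inr ⟨i, EE_sh s h⟩

variable (T)
lemma Ep_ab (y : Fin n) : Ep T (T.a y) (T.b y) := by
  rcases T.compl_left y with h | ⟨i, h1, h2⟩
  · exact Or.inl h
  · right; exact ⟨i, h1 ▸ h2 ▸ EE_ac T i⟩

lemma Ep_bc (y : Fin n) : Ep T (T.b y) (T.c y) := by
  rcases T.compl_right y with h | ⟨i, h1, h2⟩
  · exact Or.inl h
  · right; exact ⟨i, h1 ▸ h2 ▸ EE_ac T i⟩

lemma Ep_cd (j : Fin n) : Ep T (T.c j) (dd T j) := by
  unfold dd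
  split_ifs with h1 h2
  · have := Ep_sh 1 (Ep_ab T j)
    rw [h1, T.root]; rw [h1] at this; simpa using this
  · have := T.rgt j h1 h2
    rw [this.2]
    exact Or.inr ⟨_, EE_rot (EE_ac T _)⟩
  · have := T.lft j h1 (by simpa using h2)
    rw [this.2]
    exact Ep_bc T _

lemma EE_tri {i : Fin n} {x z : ℤ} (h : EE T i x z) :
    ∃ m, x < m ∧ m < z ∧ Ep T x m ∧ Ep T m z := by
  have inner : ∀ (y : Fin n) (t : ℤ), ∃ m, T.a y + t * (n + 1) < m ∧ m < T.c y + t * (n + 1) ∧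
      Ep T (T.a y + t * (n + 1)) m ∧ Ep T m (T.c y + t * (n + 1)) := by
    intro y t
    exact ⟨T.b y + t * (n + 1), by linarith [T.hab y], by linarith [T.hbc y],
      Ep_sh t (Ep_ab T y), Ep_sh t (Ep_bc T y)⟩
  obtain ⟨t, ⟨rfl, rfl⟩ | ⟨rfl, rfl⟩⟩ := h
  · exact inner i t
  · by_cases hr : i = T.r
    · obtain ⟨m, h1, h2, h3, h4⟩ := inner T.r (t + 1)
      have e1 : T.c i + t * ((n : ℤ) + 1) = T.a T.r + (t + 1) * (n + 1) := by
        rw [hr, T.root]; ring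
      have e2 : T.a i + t * ((n : ℤ) + 1) + 2 * (n + 1) = T.c T.r + (t + 1) * (n + 1) := by
        rw [hr, T.root]; ring
      rw [e1, e2]
      exact ⟨m, h1, h2, h3, h4⟩
    · have g0 := T.len (T.par i)
      have g1 := T.hab (T.par i); have g2 := T.hbc (T.par i)
      have hn := npos n
      have ho := EE_sh t (EE_rot (EE_ac T (T.par i)))
      cases hs : T.side i
      · have hl := T.lft i hr hs
        refine ⟨T.c (T.par i) + t * (n + 1), ?_, ?_, ?_, ?_⟩
        · rw [hl.2]; linarith
        · rw [hl.1]; linarith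
        · rw [hl.2]; exact Ep_sh t (Ep_bc T _)
        · right
          refine ⟨T.par i, ?_⟩
          convert ho using 1
          rw [hl.1]; ring
      · have hl := T.rgt i hr hs
        refine ⟨T.a (T.par i) + 2 * (n + 1) + t * (n + 1), ?_, ?_, ?_, ?_⟩
        · rw [hl.2]; linarith
        · rw [hl.1]; linarith
        · right; rw [hl.2]; exact ⟨_, ho⟩
        · rw [hl.1]
          have := Ep_sh (t + 2) (Ep_ab T (T.par i))
          convert this using 1 <;> ring

lemma EE_inj {i j : Fin n} (h : EE T i (T.a j) (T.c j)) : i = j := by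
  obtain ⟨t, ⟨h1, h2⟩ | ⟨h1, h2⟩⟩ := h
  · have hi := T.len i; have hj := T.len j; have wi := T.win i; have wj := T.win j
    have hro := T.root
    have hnp := npos n
    have e1 : t < 1 := lt_of_mul_lt_mul_right (a := (n : ℤ) + 1) (by omega) hnp.le
    have e2 : -1 < t := lt_of_mul_lt_mul_right (a := (n : ℤ) + 1) (by omega) hnp.le
    have : t = 0 := by omega
    subst this
    exact T.inj_ac (by omega) (by omega)
  · have hi := T.len i; have hj := T.len j; have wi := T.win i; have wj := T.win j
    have hro := T.root
    exact T.inj_ac (by omega) (by omega)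

lemma JJ_T0 (i j : Fin n) : JJ T i (T.a j) (T.b j) (T.c j) (dd T j) = if i = j then 1 else 0 := by
  have h1 := dd_lt T j; have h2 := T.hab j; have h3 := T.hbc j
  have hl := T.len j
  have hn := npos n
  split_ifs with hij
  · subst hij
    have k1 : kap (n + 1) (T.a i) (T.a i) = -1 := kap_m1 hn (by omega) (by omega)
    have k2 : kap (n + 1) (T.a i) (T.b i) = 0 := kap_0 hn (by omega) (by omega)
    have k3 : kap (n + 1) (T.a i) (T.c i) = 0 := kap_0 hn (by omega) (by omega)
    have k4 : kap (n + 1) (T.a i) (dd T i) = 0 := kap_0 hn (by omega) (by omega)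
    have k5 : kap (n + 1) (T.c i) (T.c i) = -1 := kap_m1 hn (by omega) (by omega)
    have k6 : kap (n + 1) (T.c i) (dd T i) = 0 := kap_0 hn (by omega) (by omega)
    have l1 : kap (n + 1) (T.a i + (n + 1)) (T.a i) = -1 := kap_m1 hn (by omega) (by omega)
    have l2 : kap (n + 1) (T.a i + (n + 1)) (T.b i) = -1 := kap_m1 hn (by omega) (by omega)
    by_cases hr : i = T.r
    · simp only [JJ, Jch, hr, if_true]; rw [← hr, k1, k2, k3, k4, k5, k6]; ring
    · have hlt : T.c i - T.a i < n + 1 := by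
        have := T.par_len hr; have := T.len (T.par i); omega
      have l3 : kap (n + 1) (T.c i + (n + 1)) (T.a i) = -1 := kap_m1 hn (by omega) (by omega)
      have l4 : kap (n + 1) (T.c i + (n + 1)) (T.b i) = -1 := kap_m1 hn (by omega) (by omega)
      simp only [JJ, Jch, hr, if_false, k1, k2, k3, k4, k5, k6, l1, l2, l3, l4]; ring
  · by_contra hne
    obtain ⟨x, z, e1, e2, e3, e4, e5⟩ := JJ_ex T i h2.le h3.le h1.1.le h1.2.le hne
    have hx : x = T.a j := by
      by_contra hx
      rcases Ep_ab T j with h | ⟨l, h⟩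
      · omega
      · exact EE_nc T h e5 (by omega) (by omega) (by omega) (by omega)
    have hz : z = T.c j := by
      by_contra hx
      rcases Ep_cd T j with h | ⟨l, h⟩
      · omega
      · exact EE_nc T e5 h (by omega) (by omega) (by omega) (by omega)
    subst hx hz
    exact hij (EE_inj T e5)

lemma Cm_T0 (i j : Fin n) : Cm T T i j = if i = j then 1 else 0 := by
  have h1 := dd_lt T j; have h2 := T.hab j; have h3 := T.hbc j
  unfold Cm cvq
  rw [JJ_T0]
  rcases JJ_excl T (i := j) (j := i) h2.le h3.le h1.1.le h1.2.le with h | h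
  · rw [JJ_T0] at h; simp at h
  · rw [h]; ring

lemma ext_T0 : extT T T = extMat (Bm T) := by
  funext i j
  rcases i with i | i
  · simp [extT, extMat]
  · simp [extT, extMat, Cm_T0]

lemma sign_coh (T0 : Tri n) (j : Fin n) : (∀ i, 0 ≤ Cm T0 T i j) ∨ (∀ i, Cm T0 T i j ≤ 0) := by
  have h1 := dd_lt T j; have h2 := T.hab j; have h3 := T.hbc j
  by_cases h : ∀ i, JJ T0 i (T.b j) (T.c j) (dd T j) (T.a j + 2 * (n + 1)) = 0
  · left; intro i
    have := JJ_nonneg T0 i h2.le h1.1.le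
    unfold Cm cvq; rw [h i]; linarith
  · right
    push Not at h
    obtain ⟨l, hl⟩ := h
    intro i
    have := JJ_nonneg T0 i h3.le h1.2.le
    rcases JJ_excl T0 (i := i) (j := l) h2.le h3.le h1.1.le h1.2.le with h | h
    · unfold Cm cvq; rw [h]; linarith
    · exact absurd h hl

/-- The columns of `C` are independent. -/
def CI (b : Matrix (Fin n ⊕ Fin n) (Fin n) ℤ) : Prop :=
  ∀ x : Fin n → ℤ, (∀ i, ∑ j, b (Sum.inr i) j * x j = 0) → x = 0

lemma CI_mut (b : Matrix (Fin n ⊕ Fin n) (Fin n) ℤ) (k : Fin n)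
    (hs : (∀ i, 0 ≤ b (Sum.inr i) k) ∨ (∀ i, b (Sum.inr i) k ≤ 0)) (h : CI b) :
    CI (mutMatExt k b) := by
  obtain ⟨β, hβ⟩ : ∃ β : Fin n → ℤ, ∀ i j, (b (Sum.inr i) k).sign *
      max (b (Sum.inr i) k * b (Sum.inl k) j) 0 = b (Sum.inr i) k * β j := by
    rcases hs with hs | hs
    · refine ⟨fun j => max (b (Sum.inl k) j) 0, fun i j => ?_⟩
      rcases eq_or_lt_of_le (hs i) with e | e
      · rw [← e]; simp
      · rw [Int.sign_eq_one_of_pos e, one_mul, mul_max_of_nonneg _ _ e.le]; simp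
    · refine ⟨fun j => max (-b (Sum.inl k) j) 0, fun i j => ?_⟩
      rcases eq_or_lt_of_le (hs i) with e | e
      · rw [e]; simp
      · have : max (b (Sum.inr i) k * b (Sum.inl k) j) 0 =
            - b (Sum.inr i) k * max (-b (Sum.inl k) j) 0 := by
          rw [mul_max_of_nonneg _ _ (by omega)]; simp
        rw [Int.sign_eq_neg_one_of_neg e, this]; ring
  intro x hx
  have hx' := h (fun j => if j = k then (∑ l ∈ Finset.univ.erase k, β l * x l) - x k else x j) (by
    intro i
    rw [← hx i, ← Finset.add_sum_erase _ _ (Finset.mem_univ k),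
      ← Finset.add_sum_erase _ _ (Finset.mem_univ k)]
    have e1 : mutMatExt k b (Sum.inr i) k = - b (Sum.inr i) k := by simp [mutMatExt]
    rw [e1, if_pos rfl, mul_sub, Finset.mul_sum]
    have : ∑ j ∈ Finset.univ.erase k, mutMatExt k b (Sum.inr i) j * x j =
        ∑ j ∈ Finset.univ.erase k, (b (Sum.inr i) k * (β j * x j) + b (Sum.inr i) j * x j) := by
      refine Finset.sum_congr rfl fun j hj => ?_
      have hj : j ≠ k := Finset.ne_of_mem_erase hj
      have : mutMatExt k b (Sum.inr i) j = b (Sum.inr i) j + b (Sum.inr i) k * β j := by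
        rw [← hβ]; simp [mutMatExt, hj]
      rw [this]; ring
    rw [this, Finset.sum_add_distrib]
    have : ∑ j ∈ Finset.univ.erase k, b (Sum.inr i) j *
        (if j = k then (∑ l ∈ Finset.univ.erase k, β l * x l) - x k else x j) =
        ∑ j ∈ Finset.univ.erase k, b (Sum.inr i) j * x j := by
      refine Finset.sum_congr rfl fun j hj => ?_
      rw [if_neg (Finset.ne_of_mem_erase hj)]
    rw [this]; ring)
  have h1 : ∀ j, j ≠ k → x j = 0 := by
    intro j hj
    have := congrFun hx' j
    simpa [hj] using this
  have h2 : x k = 0 := by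
    have := congrFun hx' k
    simp only [if_true, Pi.zero_apply] at this
    rw [Finset.sum_eq_zero (fun l hl => by rw [h1 l (Finset.ne_of_mem_erase hl), mul_zero])] at this
    omega
  funext j
  by_cases hj : j = k
  · rw [hj]; exact h2
  · exact h1 j hj

lemma CI_T0 : CI (extT T T) := by
  intro x hx
  funext i
  have := hx i
  simpa [extT, Cm_T0] using this

/-- All exchange matrices come from triangulations. -/
lemma IsExt_tri (T0 : Tri n) {b} (h : IsExtMat (Bm T0) b) : (∃ T, b = extT T0 T) ∧ CI b := by
  unfold IsExtMat at h
  rw [← ext_T0] at h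
  induction h with
  | refl => exact ⟨⟨T0, rfl⟩, CI_T0 T0⟩
  | tail _ h2 ih =>
    obtain ⟨⟨T, rfl⟩, hc⟩ := ih
    obtain ⟨k, rfl⟩ := h2
    obtain ⟨T', h'⟩ := flip_ext T0 T k
    refine ⟨⟨T', h'.symm⟩, CI_mut _ _ ?_ hc⟩
    simpa [extT] using sign_coh T T0 k

lemma CVec_tri (T0 : Tri n) {c} (h : IsCVec (Bm T0) c) :
    c ≠ 0 ∧ ((∀ i, 0 ≤ c i) ∨ (∀ i, c i ≤ 0)) ∧ ∃ T j, c = fun i => Cm T0 T i j := by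
  obtain ⟨b, hb, j, rfl⟩ := h
  obtain ⟨⟨T, rfl⟩, hc⟩ := IsExt_tri T0 hb
  refine ⟨?_, ?_, T, j, ?_⟩
  · intro h0
    have := hc (Pi.single j 1) (fun i => by
      have := congrFun h0 i
      simp only [Pi.zero_apply] at this
      simp [Pi.single_apply, this])
    have := congrFun this j
    simp at this
  · simpa [extT] using sign_coh T T0 j
  · simp [extT]

lemma CVec_neg {B : Matrix (Fin n) (Fin n) ℤ} {c} (h : IsCVec B c) : IsCVec B (-c) := by
  obtain ⟨b, hb, j, rfl⟩ := h
  refine ⟨mutMatExt j b, hb.tail ⟨j, rfl⟩, j, ?_⟩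
  funext i
  simp [mutMatExt]

end


section
variable {n : ℕ} (T : Tri n)

/-- crossing vector of the diagonal `(g,h)` -/
def XX (g h : ℤ) (i : Fin n) : ℤ := JJ T i (h - 2 * (n + 1) + 1) g (g + 1) h

lemma XX_sh1 (g h : ℤ) : XX T (g + (n + 1)) (h + (n + 1)) = XX T g h := by
  funext i
  unfold XX
  rw [← JJ_shN T i (h - 2 * (n + 1) + 1)]
  congr 1 <;> ring

lemma XX_sh (g h t : ℤ) : XX T (g + t * (n + 1)) (h + t * (n + 1)) = XX T g h := by
  induction t using Int.induction_on with
  | zero => simp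
  | succ t ih =>
    rw [← ih, ← XX_sh1 T (g + t * (n + 1))]; congr 1 <;> ring
  | pred t ih =>
    rw [← ih, ← XX_sh1 T (g + (-(t : ℤ) - 1) * (n + 1))]; congr 1 <;> ring

lemma XX_rot (g h : ℤ) : XX T h (g + 2 * (n + 1)) = XX T g h := by
  funext i
  unfold XX
  rw [JJ_symm T i (h - 2 * (n + 1) + 1), ← JJ_sh2 T i (g + 1) h (h - 2 * (n + 1) + 1)]
  congr 1 <;> ring

variable {T}
lemma EE_rot' {i : Fin n} {x z : ℤ} (h : EE T i z (x + 2 * (n + 1))) : EE T i x z := by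
  have := EE_sh (-2) (EE_rot h)
  convert this using 1 <;> ring

variable (T)
lemma JJ_XX {a b c d : ℤ} (h1 : a < b) (h2 : b < c) (h3 : c < d) (h4 : d < a + 2 * (n + 1))
    (hne : ∃ i, JJ T i a b c d ≠ 0) : ∃ g h : ℤ, 2 ≤ h - g ∧ h - g ≤ 2 * (n + 1) - 2 ∧
    (∀ i, ¬ EE T i g h) ∧ ∀ i, JJ T i a b c d = XX T g h i := by
  classical
  obtain ⟨i0, hi0⟩ := hne
  obtain ⟨x0, z0, e1, e2, e3, e4, e5⟩ := JJ_ex T i0 h1.le h2.le h3.le h4.le hi0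
  let S := (Finset.Ico a b ×ˢ Finset.Ico c d).filter (fun p => ∃ i, EE T i p.1 p.2)
  have hS : (x0, z0) ∈ S := by
    simp only [S, Finset.mem_filter, Finset.mem_product, Finset.mem_Ico]
    exact ⟨⟨⟨e1, e2⟩, e3, e4⟩, i0, e5⟩
  have mS : ∀ x z, (x, z) ∈ S ↔ (a ≤ x ∧ x < b) ∧ (c ≤ z ∧ z < d) ∧ ∃ i, EE T i x z := by
    intro x z
    simp only [S, Finset.mem_filter, Finset.mem_product, Finset.mem_Ico, and_assoc]
  obtain ⟨⟨x, z⟩, hxz, hmin⟩ := S.exists_min_image (fun p => p.2 - p.1) ⟨_, hS⟩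
  obtain ⟨⟨x', z'⟩, hxz', hmax⟩ := S.exists_max_image (fun p => p.2 - p.1) ⟨_, hS⟩
  rw [mS] at hxz hxz'
  obtain ⟨⟨x1, x2⟩, ⟨z1, z2⟩, i, hE⟩ := hxz
  obtain ⟨⟨x1', x2'⟩, ⟨z1', z2'⟩, i', hE'⟩ := hxz'
  -- inner apex
  obtain ⟨g, g1, g2, g3, g4⟩ := EE_tri T hE
  have gb : b ≤ g := by
    by_contra hb
    rcases g4 with g4 | ⟨l, g4⟩
    · omega
    · have := hmin (g, z) ((mS _ _).2 ⟨⟨by omega, by omega⟩, ⟨z1, z2⟩, l, g4⟩)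
      simp only at this; omega
  have gc : g < c := by
    by_contra hb
    rcases g3 with g3 | ⟨l, g3⟩
    · omega
    · have := hmin (x, g) ((mS _ _).2 ⟨⟨by omega, by omega⟩, ⟨by omega, by omega⟩, l, g3⟩)
      simp only at this; omega
  -- outer apex
  obtain ⟨h, f1, f2, f3, f4⟩ := EE_tri T (EE_rot hE')
  have hd : d ≤ h := by
    by_contra hb
    rcases f4 with f4 | ⟨l, f4⟩
    · omega
    · have := hmax (x', h) ((mS _ _).2 ⟨⟨by omega, by omega⟩, ⟨by omega, by omega⟩, l, EE_rot' f4⟩)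
      simp only at this; omega
  have ha : h < a + 2 * (n + 1) := by
    by_contra hb
    rcases f3 with f3 | ⟨l, f3⟩
    · omega
    · have := hmax (h - 2 * (n + 1), z') ((mS _ _).2 ⟨⟨by omega, by omega⟩, ⟨by omega, by omega⟩, l,
        EE_rot' (by convert f3 using 1; ring)⟩)
      simp only at this; omega
  have crossall : ∀ l u w, h - 2 * (n + 1) + 1 ≤ u → u < g → g + 1 ≤ w → w < h → EE T l u w →
      a ≤ u ∧ u < b ∧ c ≤ w ∧ w < d := by
    intro l u w u1 u2 w1 w2 huw
    refine ⟨?_, ?_, ?_, ?_⟩ <;> by_contra hcon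
    · rcases f4 with f4 | ⟨l', f4⟩
      · omega
      · exact EE_nc T (EE_rot huw) f4 (by omega) (by omega) (by omega) (by omega)
    · rcases g3 with g3 | ⟨l', g3⟩
      · omega
      · exact EE_nc T g3 huw (by omega) (by omega) (by omega) (by omega)
    · rcases g4 with g4 | ⟨l', g4⟩
      · omega
      · exact EE_nc T huw g4 (by omega) (by omega) (by omega) (by omega)
    · rcases f3 with f3 | ⟨l', f3⟩
      · omega
      · exact EE_nc T huw f3 (by omega) (by omega) (by omega) (by omega)
  refine ⟨g, h, by omega, by omega, ?_, ?_⟩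
  · intro l hl
    exact EE_nc T hE hl (by omega) (by omega) (by omega) (by omega)
  · intro l
    unfold XX
    have s1 := JJ_add1 T l (h - 2 * (n + 1) + 1) a g (g + 1) h
    have s2 := JJ_add1 T l a b g (g + 1) h
    have s3 := JJ_add2 T l (g + 1) c h a b
    have s4 := JJ_add2 T l c d h a b
    have t1 : JJ T l (h - 2 * (n + 1) + 1) a (g + 1) h = 0 := by
      by_contra hn
      obtain ⟨u, w, q1, q2, q3, q4, q5⟩ := JJ_ex T l (by omega) (by omega) (by omega) (by omega) hn
      have := crossall l u w (by omega) (by omega) (by omega) (by omega) q5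
      omega
    have t2 : JJ T l b g (g + 1) h = 0 := by
      by_contra hn
      obtain ⟨u, w, q1, q2, q3, q4, q5⟩ := JJ_ex T l (by omega) (by omega) (by omega) (by omega) hn
      have := crossall l u w (by omega) (by omega) (by omega) (by omega) q5
      omega
    have t3 : JJ T l a b (g + 1) c = 0 := by
      by_contra hn
      obtain ⟨u, w, q1, q2, q3, q4, q5⟩ := JJ_ex T l (by omega) (by omega) (by omega) (by omega) hn
      have := crossall l u w (by omega) (by omega) (by omega) (by omega) q5
      omega
    have t4 : JJ T l a b d h = 0 := by
      by_contra hn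
      obtain ⟨u, w, q1, q2, q3, q4, q5⟩ := JJ_ex T l (by omega) (by omega) (by omega) (by omega) hn
      have := crossall l u w (by omega) (by omega) (by omega) (by omega) q5
      omega
    omega

lemma XX_norm {g h : ℤ} (h1 : 2 ≤ h - g) (h2 : h - g ≤ 2 * (n + 1) - 2)
    (h3 : ∀ i, ¬ EE T i g h) : ∃ g' h' : ℤ, 0 ≤ g' ∧ g' < n + 1 ∧ 2 ≤ h' - g' ∧ h' - g' ≤ n + 1 ∧
      (∀ i, ¬ EE T i g' h') ∧ XX T g h = XX T g' h' := by
  have main : ∀ g h : ℤ, 2 ≤ h - g → h - g ≤ n + 1 → (∀ i, ¬ EE T i g h) →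
    ∃ g' h' : ℤ, 0 ≤ g' ∧ g' < n + 1 ∧ 2 ≤ h' - g' ∧ h' - g' ≤ n + 1 ∧
      (∀ i, ¬ EE T i g' h') ∧ XX T g h = XX T g' h' := by
    intro g h h1 h2 h3
    have e1 := Int.emod_add_mul_ediv g ((n : ℤ) + 1)
    have e2 := Int.emod_nonneg g (b := (n : ℤ) + 1) (by omega)
    have e3 := Int.emod_lt_of_pos g (b := (n : ℤ) + 1) (by omega)
    refine ⟨g + (-(g / ((n : ℤ) + 1))) * (n + 1), h + (-(g / ((n : ℤ) + 1))) * (n + 1), ?_, ?_, ?_,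
      ?_, ?_, (XX_sh T _ _ _).symm⟩
    · linarith
    · linarith
    · linarith
    · linarith
    · intro i hi
      apply h3 i
      have := EE_sh (g / ((n : ℤ) + 1)) hi
      convert this using 1 <;> ring
  by_cases hh : h - g ≤ n + 1
  · exact main g h h1 hh h3
  · obtain ⟨g', h', q⟩ := main h (g + 2 * (n + 1)) (by omega) (by omega)
      (fun i hi => h3 i (EE_rot' hi))
    rw [XX_rot] at q
    exact ⟨g', h', q⟩

def posC (B : Matrix (Fin n) (Fin n) ℤ) : Set (Fin n → ℤ) :=
  {c | IsCVec B c ∧ c ≠ 0 ∧ ∀ i, 0 ≤ c i}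

lemma posC_XX {c : Fin n → ℤ} (hc : c ∈ posC (Bm T)) :
    ∃ g h : ℤ, 0 ≤ g ∧ g < n + 1 ∧ 2 ≤ h - g ∧ h - g ≤ n + 1 ∧
      (∀ i, ¬ EE T i g h) ∧ c = XX T g h := by
  obtain ⟨hc, hn, hp⟩ := hc
  obtain ⟨-, -, T', j, rfl⟩ := CVec_tri T hc
  have h1 := dd_lt T' j; have h2 := T'.hab j; have h3 := T'.hbc j
  obtain ⟨i, hi⟩ := Function.ne_iff.1 hn
  simp only [Pi.zero_apply] at hi
  have hpi := hp i
  have hJi : JJ T i (T'.a j) (T'.b j) (T'.c j) (dd T' j) ≠ 0 := by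
    have := JJ_nonneg T i h3.le h1.2.le
    simp only [Cm, cvq] at hi hpi
    omega
  have h0 : ∀ l, JJ T l (T'.b j) (T'.c j) (dd T' j) (T'.a j + 2 * (n + 1)) = 0 := by
    intro l
    rcases JJ_excl T (i := i) (j := l) h2.le h3.le h1.1.le h1.2.le with h | h
    · exact absurd h hJi
    · exact h
  obtain ⟨g, h, q1, q2, q3, q4⟩ := JJ_XX T h2 h3 h1.1 h1.2 ⟨i, hJi⟩
  obtain ⟨g', h', r1, r2, r3, r4, r5, r6⟩ := XX_norm T q1 q2 q3
  refine ⟨g', h', r1, r2, r3, r4, r5, ?_⟩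
  rw [← r6]
  funext l
  unfold Cm cvq
  rw [h0, q4]; ring

lemma upper : (posC (Bm T)).Finite ∧ (posC (Bm T)).ncard ≤ n ^ 2 := by
  classical
  let G : Finset (ℤ × ℤ) := Finset.Ico 0 ((n : ℤ) + 1) ×ˢ Finset.Icc 2 ((n : ℤ) + 1)
  let f : Fin n → ℤ × ℤ := fun i => (T.a i % (n + 1), T.c i - T.a i)
  have hf : Function.Injective f := by
    intro i j hij
    simp only [f, Prod.mk.injEq] at hij
    apply EE_inj T
    refine ⟨T.a j / (n + 1) - T.a i / (n + 1), Or.inl ?_⟩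
    have e1 := Int.emod_add_mul_ediv (T.a i) ((n : ℤ) + 1)
    have e2 := Int.emod_add_mul_ediv (T.a j) ((n : ℤ) + 1)
    constructor
    · linarith
    · linarith
  have hfG : Finset.univ.image f ⊆ G := by
    intro p hp
    simp only [Finset.mem_image, Finset.mem_univ, true_and] at hp
    obtain ⟨i, rfl⟩ := hp
    have e2 := Int.emod_nonneg (T.a i) (b := (n : ℤ) + 1) (by omega)
    have e3 := Int.emod_lt_of_pos (T.a i) (b := (n : ℤ) + 1) (by omega)
    have := T.len i; have := T.hab i; have := T.hbc i
    simp only [G, f, Finset.mem_product, Finset.mem_Ico, Finset.mem_Icc]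
    omega
  let F := (G \ Finset.univ.image f).image (fun p => XX T p.1 (p.1 + p.2))
  have hcard : F.card ≤ n ^ 2 := by
    refine Finset.card_image_le.trans ?_
    rw [Finset.card_sdiff_of_subset hfG, Finset.card_image_of_injective _ hf]
    simp only [G, Finset.card_product, Int.card_Ico, Int.card_Icc, Finset.card_univ,
      Fintype.card_fin]
    have e1 : ((n : ℤ) + 1 - 0).toNat = n + 1 := by omega
    have e2 : ((n : ℤ) + 1 + 1 - 2).toNat = n := by omega
    rw [e1, e2]
    have : (n + 1) * n = n ^ 2 + n := by ring
    omega
  have hsub : posC (Bm T) ⊆ (F : Set (Fin n → ℤ)) := by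
    intro c hc
    obtain ⟨g, h, r1, r2, r3, r4, r5, rfl⟩ := posC_XX T hc
    simp only [F, Finset.coe_image, Set.mem_image]
    refine ⟨(g, h - g), ?_, by simp⟩
    simp only [G, Finset.coe_sdiff, Set.mem_sdiff, Finset.mem_coe, Finset.mem_product,
      Finset.mem_Ico, Finset.mem_Icc, Finset.mem_image, Finset.mem_univ, true_and, not_exists]
    refine ⟨⟨⟨r1, r2⟩, r3, r4⟩, ?_⟩
    intro i hi
    simp only [f, Prod.mk.injEq] at hi
    apply r5 i
    have e1 := Int.emod_add_mul_ediv (T.a i) ((n : ℤ) + 1)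
    exact ⟨-(T.a i / (n + 1)), Or.inl ⟨by linarith, by linarith⟩⟩
  refine ⟨F.finite_toSet.subset hsub, ?_⟩
  calc _ ≤ (F : Set (Fin n → ℤ)).ncard := Set.ncard_le_ncard hsub F.finite_toSet
    _ = F.card := Set.ncard_coe_finset F
    _ ≤ _ := hcard

end


section
variable {n : ℕ} (T0 : Tri n)

def Rch (T : Tri n) : Prop := IsExtMat (Bm T0) (extT T0 T)

variable {T0}
lemma Rch.step {T T' : Tri n} {k : Fin n} (h : Rch T0 T) (h2 : extT T0 T' = mutMatExt k (extT T0 T)) :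
    Rch T0 T' := Relation.ReflTransGen.tail h ⟨k, h2⟩

lemma Rch.cvec {T : Tri n} (h : Rch T0 T) (j : Fin n) : IsCVec (Bm T0) (fun i => Cm T0 T i j) :=
  ⟨_, h, j, by simp [extT]⟩

lemma Rch_self (T0 : Tri n) : Rch T0 T0 := by
  unfold Rch; rw [ext_T0]; exact Relation.ReflTransGen.refl

lemma fan_exists (m : ℕ) : ∀ T : Tri n, Rch T0 T →
    (Finset.univ.filter (fun j => T.a j ≠ T.a T.r)).card = m →
    ∃ T', Rch T0 T' ∧ ∀ j, T'.a j = T'.a T'.r := by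
  classical
  induction m with
  | zero =>
    intro T hT hm
    refine ⟨T, hT, fun j => ?_⟩
    rw [Finset.card_eq_zero, Finset.filter_eq_empty_iff] at hm
    simpa using hm (Finset.mem_univ j)
  | succ m ih =>
    intro T hT hm
    have hne : (Finset.univ.filter (fun j => T.a j ≠ T.a T.r)).Nonempty := by
      rw [← Finset.card_pos]; omega
    obtain ⟨j, hj, hmax⟩ := Finset.exists_max_image _ (fun j => T.c j - T.a j) hne
    simp only [Finset.mem_filter, Finset.mem_univ, true_and] at hj hmax
    have hjr : j ≠ T.r := by rintro rfl; exact hj rfl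
    have hp : T.a (T.par j) = T.a T.r := by
      by_contra hcon
      have := hmax _ hcon
      have := T.par_len hjr
      omega
    have hs : T.side j = true := by
      by_contra hs
      have := T.lft j hjr (by simpa using hs)
      omega
    obtain ⟨T', hT'⟩ := RF_exists T j hjr hs
    have hpn := T.par_ne hjr
    have hpk : T'.par j = T.par j := hT'.pk.symm
    have haj : T'.a j = T.a T.r := by
      rw [(T'.lft j hT'.hk hT'.sk).1, hpk, ← hT'.aj _ hpn, hp]
    have har : T'.a T'.r = T.a T.r := by
      rw [← hT'.hr, ← hT'.aj _ (Ne.symm hjr)]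
    refine ih T' (hT.step (LF_ext' T0 hT')) ?_
    have : (Finset.univ.filter (fun i => T'.a i ≠ T'.a T'.r)) =
        (Finset.univ.filter (fun i => T.a i ≠ T.a T.r)).erase j := by
      ext i
      simp only [Finset.mem_filter, Finset.mem_univ, true_and, Finset.mem_erase, har]
      by_cases hi : i = j
      · subst hi; simp [haj]
      · rw [← hT'.aj i hi]; simp [hi]
    rw [this, Finset.card_erase_of_mem (by simpa using hj), hm]; rfl

/-- belt state -/
structure Belt (L : Fin n → ℤ) (T : Tri n) (x s : ℤ) : Prop where
  h1 : ∀ j, s ≤ L j → T.a j = x ∧ T.c j = x + L j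
  h2 : ∀ j, L j < s → T.a j = x + 1 ∧ T.c j = x + 1 + L j

structure LenF (L : Fin n → ℤ) : Prop where
  inj : Function.Injective L
  lo : ∀ j, 2 ≤ L j
  hi : ∀ j, L j ≤ n + 1
  sur : ∀ s : ℤ, 2 ≤ s → s ≤ n + 1 → ∃ j, L j = s

lemma fan_belt (T : Tri n) (h : ∀ j, T.a j = T.a T.r) :
    ∃ L, LenF L ∧ Belt L T (T.a T.r) 2 := by
  classical
  have lo : ∀ j, 2 ≤ T.c j - T.a j := fun j => by have := T.hab j; have := T.hbc j; omega
  have hi : ∀ j, T.c j - T.a j ≤ n + 1 := fun j => by have := T.len j; omega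
  have inj : Function.Injective (fun j => T.c j - T.a j) := by
    intro i j hij
    simp only at hij
    have := h i; have := h j
    exact T.inj_ac (by omega) (by omega)
  refine ⟨fun j => T.c j - T.a j, ⟨inj, lo, hi, ?_⟩, ⟨?_, ?_⟩⟩
  · intro s s1 s2
    have hsub : Finset.univ.image (fun j => T.c j - T.a j) ⊆ Finset.Icc 2 ((n : ℤ) + 1) := by
      intro y hy
      simp only [Finset.mem_image, Finset.mem_univ, true_and] at hy
      obtain ⟨j, rfl⟩ := hy
      exact Finset.mem_Icc.2 ⟨lo j, hi j⟩
    have := Finset.eq_of_subset_of_card_le hsub (by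
      rw [Finset.card_image_of_injective _ inj, Int.card_Icc]; simp)
    have hx : s ∈ Finset.univ.image (fun j => T.c j - T.a j) := by rw [this]; simp [s1, s2]
    simpa using hx
  · intro j _; exact ⟨h j, by have := h j; omega⟩
  · intro j hj; have := lo j; omega

lemma belt_quad {L : Fin n → ℤ} (hL : LenF L) {T : Tri n} {x s : ℤ} (hB : Belt L T x s)
    {j : Fin n} (hj : L j = s) : T.a j = x ∧ T.b j = x + 1 ∧ T.c j = x + s ∧ dd T j = x + s + 1 ∧
      (j ≠ T.r → T.side j = false ∧ T.c (T.par j) = x + s + 1) ∧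
      (j = T.r → s = n + 1) := by
  have ha := hB.h1 j hj.ge
  rw [hj] at ha
  have hax : ∀ i, T.a i = x ∨ T.a i = x + 1 := fun i => by
    by_cases h : s ≤ L i
    · exact Or.inl (hB.h1 i h).1
    · exact Or.inr (hB.h2 i (by omega)).1
  have hb : T.b j = x + 1 := by
    have := T.hab j; have := T.hbc j
    rcases T.compl_left j with h | ⟨i, h3, h4⟩
    · omega
    · exfalso
      by_cases h : s ≤ L i
      · have := hB.h1 i h; omega
      · have := hB.h2 i (by omega); omega
  have h5 : j ≠ T.r → T.side j = false ∧ T.c (T.par j) = x + s + 1 := by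
    intro hr
    have hs : T.side j = false := by
      by_contra hs
      have := T.rgt j hr (by simpa using hs)
      have := T.hab (T.par j); have := hax (T.par j); omega
    refine ⟨hs, ?_⟩
    have := T.lft j hr hs
    have := hL.lo j
    rcases T.compl_right (T.par j) with h | ⟨i, h3, h4⟩
    · omega
    · have := hax i; omega
  have h6 : j = T.r → s = n + 1 := by
    intro h
    have := T.root; rw [← h] at this; omega
  refine ⟨ha.1, hb, ha.2, ?_, h5, h6⟩
  unfold dd
  split_ifs with e1 e2
  · rw [hb, h6 e1]; ring
  · have := (h5 e1).1; rw [e2] at this; exact absurd this (by simp)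
  · exact (h5 e1).2

lemma belt_step {L : Fin n → ℤ} (hL : LenF L) {T : Tri n} {x s : ℤ} (hB : Belt L T x s)
    (hT : Rch T0 T) (s1 : 2 ≤ s) (s2 : s ≤ n + 1) : ∃ T', Rch T0 T' ∧
      if s = n + 1 then Belt L T' (x + 1) 2 else Belt L T' x (s + 1) := by
  obtain ⟨j, hj⟩ := hL.sur s s1 s2
  obtain ⟨q1, q2, q3, q4, q5, q6⟩ := belt_quad hL hB hj
  have hinj : ∀ i, i ≠ j → L i ≠ s := fun i hi h => hi (hL.inj (h.trans hj.symm))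
  by_cases hr : j = T.r
  · have hsn := q6 hr
    simp only [if_pos hsn]
    obtain ⟨T', hT'⟩ := RootF_exists T
    refine ⟨T', hT.step (RootF_ext T0 hT'), ⟨fun i _ => ?_, fun i hi => ?_⟩⟩
    · by_cases hi : i = j
      · subst hi
        have := hT'.ar; have := hT'.cr
        rw [← hr] at *
        omega
      · have := hinj i hi
        have := hL.hi i
        have h2 := hB.h2 i (by omega)
        have sh := hT'.sh i (hr ▸ hi)
        rw [← hr] at sh
        have := hL.lo i
        omega
    · have := hL.lo i; omega
  · have hq := q5 hr
    have hsn : s ≠ n + 1 := by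
      have := T.par_len hr; have := T.len (T.par j); omega
    simp only [if_neg hsn]
    obtain ⟨T', hT'⟩ := LF_exists T j hr hq.1
    refine ⟨T', hT.step (LF_ext T0 hT'), ⟨fun i hi => ?_, fun i hi => ?_⟩⟩
    · have hij : i ≠ j := by rintro rfl; omega
      rw [hT'.aj i hij, hT'.cj i hij]
      exact hB.h1 i (by omega)
    · by_cases hij : i = j
      · subst hij
        rw [hT'.ak, hT'.ck, hq.2, q2]; omega
      · rw [hT'.aj i hij, hT'.cj i hij]
        have := hinj i hij
        exact hB.h2 i (by omega)

lemma belt_all (T0 : Tri n) : ∃ (L : Fin n → ℤ) (x0 : ℤ), LenF L ∧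
    ∀ (m : ℕ) (s : ℤ), 2 ≤ s → s ≤ n + 1 → ∃ T, Rch T0 T ∧ Belt L T (x0 + m) s := by
  obtain ⟨T, hT, hf⟩ := fan_exists _ T0 (Rch_self T0) rfl
  obtain ⟨L, hL, hB⟩ := fan_belt T hf
  refine ⟨L, T.a T.r, hL, ?_⟩
  have inner : ∀ x : ℤ, (∃ T, Rch T0 T ∧ Belt L T x 2) → ∀ k : ℕ, 2 + (k : ℤ) ≤ n + 1 →
      ∃ T, Rch T0 T ∧ Belt L T x (2 + k) := by
    intro x hx k
    induction k with
    | zero => intro _; simpa using hx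
    | succ k ih =>
      intro hk
      push_cast at hk
      obtain ⟨T, h1, h2⟩ := ih (by omega)
      obtain ⟨T', h1', h2'⟩ := belt_step hL h2 h1 (by omega) (by omega)
      rw [if_neg (by omega)] at h2'
      refine ⟨T', h1', ?_⟩
      push_cast; rwa [← add_assoc]
  have n1 : 1 ≤ n := Nat.succ_le_of_lt (Fin.pos T.r)
  have outer : ∀ m : ℕ, ∃ T', Rch T0 T' ∧ Belt L T' (T.a T.r + m) 2 := by
    intro m
    induction m with
    | zero => exact ⟨T, hT, by simpa using hB⟩
    | succ m ih =>
      obtain ⟨T', h1, h2⟩ := inner _ ih (n - 1) (by omega)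
      obtain ⟨T'', h1', h2'⟩ := belt_step hL h2 h1 (by omega) (by omega)
      rw [if_pos (by omega)] at h2'
      refine ⟨T'', h1', ?_⟩
      push_cast; rwa [← add_assoc]
  intro m s s1 s2
  obtain ⟨T', h⟩ := inner _ (outer m) (s - 2).toNat (by omega)
  have : (2 : ℤ) + ((s - 2).toNat : ℤ) = s := by omega
  rw [this] at h
  exact ⟨T', h⟩

lemma cvq_all (T0 : Tri n) (x s : ℤ) (s1 : 2 ≤ s) (s2 : s ≤ n + 1) :
    IsCVec (Bm T0) (fun i => cvq T0 i x (x + 1) (x + s) (x + s + 1)) := by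
  obtain ⟨L, x0, hL, hall⟩ := belt_all T0
  have hsh : ∀ (k : ℕ) (x : ℤ) i, cvq T0 i (x + k * (n + 1)) (x + k * (n + 1) + 1)
      (x + k * (n + 1) + s) (x + k * (n + 1) + s + 1) = cvq T0 i x (x + 1) (x + s) (x + s + 1) := by
    intro k x i
    induction k with
    | zero => simp
    | succ k ih =>
      rw [← ih, ← cvq_shN T0 i (x + k * (n + 1))]
      congr 1 <;> push_cast <;> ring
  have hk : x0 ≤ x + ((x0 - x).toNat : ℕ) * ((n : ℤ) + 1) := by
    have h1 : x0 - x ≤ ((x0 - x).toNat : ℤ) := Int.self_le_toNat _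
    have h2 : (0 : ℤ) ≤ ((x0 - x).toNat : ℤ) := by positivity
    nlinarith [npos n]
  simp_rw [← hsh (x0 - x).toNat x]
  obtain ⟨T, hT, hB⟩ := hall (x + ((x0 - x).toNat : ℕ) * ((n : ℤ) + 1) - x0).toNat s s1 s2
  have e : x0 + (((x + ((x0 - x).toNat : ℕ) * ((n : ℤ) + 1) - x0).toNat : ℕ) : ℤ) =
      x + ((x0 - x).toNat : ℕ) * ((n : ℤ) + 1) := by
    rw [Int.toNat_of_nonneg (by linarith)]; ring
  rw [e] at hB
  obtain ⟨j, hj⟩ := hL.sur s s1 s2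
  obtain ⟨q1, q2, q3, q4, -, -⟩ := belt_quad hL hB hj
  have := hT.cvec j
  unfold Cm at this
  rwa [q1, q2, q3, q4] at this

lemma XX_posC (T0 : Tri n) {g h : ℤ} (h1 : 2 ≤ h - g) (h2 : h - g ≤ n + 1)
    (h3 : ∀ i, ¬ EE T0 i g h) : XX T0 g h ∈ posC (Bm T0) := by
  have := CVec_neg (cvq_all T0 g (h - g) h1 h2)
  have e : (-(fun i => cvq T0 i g (g + 1) (g + (h - g)) (g + (h - g) + 1))) = XX T0 g h := by
    funext i
    have e1 : g + (h - g) = h := by ring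
    rw [← XX_rot]
    simp only [Pi.neg_apply, e1, cvq, XX]
    have : JJ T0 i g (g + 1) h (h + 1) = 0 := by
      by_contra hne
      obtain ⟨x, y, a1, a2, a3, a4, a5⟩ := JJ_ex T0 i (by omega) (by omega) (by omega) (by omega) hne
      have : x = g := by omega
      have : y = h := by omega
      subst x y
      exact h3 i a5
    rw [this]
    have e2 : g + 2 * ((n : ℤ) + 1) - 2 * (n + 1) + 1 = g + 1 := by ring
    rw [e2]; ring
  rw [e] at this
  refine ⟨this, (CVec_tri T0 this).1, fun i => ?_⟩
  unfold XX
  exact JJ_nonneg _ _ (by omega) (by omega)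

end


lemma JX_aux {N p q g h : ℤ} (hN : 0 < N) : Jch N p q (h - 2 * N + 1) g (g + 1) h =
    (kap N p g - kap N p (h + 1) + 1) * (kap N q h - kap N q (g + 1)) +
    (kap N q g - kap N q (h + 1) + 1) * (kap N p h - kap N p (g + 1)) := by
  have e : h + 1 = (h - 2 * N + 1) + 2 * N := by ring
  unfold Jch
  rw [e, kap_sh hN, kap_sh hN]; ring

lemma JX1 {N p q g h : ℤ} (hN : 0 < N) (h1 : p < g) (h2 : g < q) (h3 : q < h)
    (h4 : h < p + 2 * N) : Jch N p q (h - 2 * N + 1) g (g + 1) h = 1 := by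
  rw [JX_aux hN, kap_0 hN (p := p) (x := g) (by omega) (by omega),
    kap_0 hN (p := p) (x := h + 1) (by omega) (by omega),
    kap_0 hN (p := q) (x := h) (by omega) (by omega),
    kap_m1 hN (p := q) (x := g + 1) (by omega) (by omega),
    kap_m1 hN (p := q) (x := g) (by omega) (by omega),
    kap_0 hN (p := q) (x := h + 1) (by omega) (by omega)]
  ring

lemma JX2 {N p q g h : ℤ} (hN : 0 < N) (h1 : g < p) (h2 : p < h) (h3 : h < q)
    (h4 : q < g + 2 * N) : Jch N p q (h - 2 * N + 1) g (g + 1) h = 1 := by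
  rw [JX_aux hN, kap_m1 hN (p := p) (x := g) (by omega) (by omega),
    kap_0 hN (p := p) (x := h + 1) (by omega) (by omega),
    kap_m1 hN (p := q) (x := g) (by omega) (by omega),
    kap_m1 hN (p := q) (x := h + 1) (by omega) (by omega),
    kap_0 hN (p := p) (x := h) (by omega) (by omega),
    kap_m1 hN (p := p) (x := g + 1) (by omega) (by omega)]
  ring

lemma kap_lo {N p x : ℤ} (hN : 0 < N) (h : p < x) (h' : x ≤ p + 2 * N) :
    kap N p x = 0 := kap_0 hN h h'

/-- an arc nested inside `[g, h]` does not cross -/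
lemma JX3 {N p q g h : ℤ} (hN : 0 < N) (h1 : g ≤ p) (h2 : p < q) (h3 : q ≤ h)
    (h4 : h < g + 2 * N) : Jch N p q (h - 2 * N + 1) g (g + 1) h = 0 := by
  rw [JX_aux hN, kap_m1 hN (p := p) (x := g) (by omega) (by omega),
    kap_0 hN (p := p) (x := h + 1) (by omega) (by omega),
    kap_m1 hN (p := q) (x := g) (by omega) (by omega),
    kap_0 hN (p := q) (x := h + 1) (by omega) (by omega)]
  ring

/-- an arc enclosing `[g, h]` does not cross -/
lemma JX4 {N p q g h : ℤ} (hN : 0 < N) (h1 : p ≤ g) (h2 : g < h) (h3 : h ≤ q)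
    (h4 : q < p + 2 * N) : Jch N p q (h - 2 * N + 1) g (g + 1) h = 0 := by
  rw [JX_aux hN,
    kap_m1 hN (p := q) (x := h) (by omega) (by omega),
    kap_m1 hN (p := q) (x := g + 1) (by omega) (by omega),
    kap_0 hN (p := p) (x := h) (by omega) (by omega),
    kap_0 hN (p := p) (x := g + 1) (by omega) (by omega)]
  ring

/-- an arc to the left of `[g, h]` does not cross -/
lemma JX5 {N p q g h : ℤ} (hN : 0 < N) (h1 : p < q) (h2 : q ≤ g) (h3 : g < h)
    (h4 : h ≤ p + 2 * N) : Jch N p q (h - 2 * N + 1) g (g + 1) h = 0 := by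
  rw [JX_aux hN,
    kap_0 hN (p := q) (x := h) (by omega) (by omega),
    kap_0 hN (p := q) (x := g + 1) (by omega) (by omega),
    kap_0 hN (p := p) (x := h) (by omega) (by omega),
    kap_0 hN (p := p) (x := g + 1) (by omega) (by omega)]
  ring

/-- an arc to the right of `[g, h]` does not cross -/
lemma JX6 {N p q g h : ℤ} (hN : 0 < N) (h1 : p < q) (h2 : h ≤ p) (h3 : g < h)
    (h4 : q ≤ g + 2 * N) : Jch N p q (h - 2 * N + 1) g (g + 1) h = 0 := by
  rw [JX_aux hN,
    kap_m1 hN (p := q) (x := h) (by omega) (by omega),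
    kap_m1 hN (p := q) (x := g + 1) (by omega) (by omega),
    kap_m1 hN (p := p) (x := h) (by omega) (by omega),
    kap_m1 hN (p := p) (x := g + 1) (by omega) (by omega)]
  ring

section
variable {n : ℕ} (T : Tri n)

/-- the interval of `i` contains the splitting point of `j` -/
def PP (i j : Fin n) : Prop := T.a i < T.b j ∧ T.b j < T.c i

open Classical in
lemma XX_type1 {j k : Fin n} (hjk : T.b k ≤ T.b j) : ∃ V ∈ posC (Bm T), V T.r = 1 ∧
    ∀ i, i ≠ T.r → V i = (if PP T i j then 1 else 0) + (if PP T i k then 1 else 0) := by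
  have hN := npos n
  have w := T.win; have ro := T.root
  have b1 := T.hab j; have b2 := T.hbc j; have b3 := T.hab k; have b4 := T.hbc k
  have w1 := w j; have w2 := w k
  refine ⟨XX T (T.b j) (T.b k + (n + 1)), XX_posC T (by omega) (by omega) ?_, ?_, ?_⟩
  · intro i hi
    exact EE_nc T (EE_ac T T.r) hi (by omega) (by omega) (by omega) (by omega)
  · unfold XX JJ
    rw [if_pos rfl, JX1 hN (by omega) (by omega) (by omega) (by omega)]; ring
  · intro i hi
    have c1 := T.hab i; have c2 := T.hbc i; have w3 := w i
    unfold XX JJ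
    rw [if_neg hi]
    congr 1
    · split_ifs with h
      · obtain ⟨h1, h2⟩ := h
        exact JX1 hN (by omega) (by omega) (by omega) (by omega)
      · unfold PP at h
        by_cases h' : T.b j ≤ T.a i
        · exact JX3 hN (by omega) (by omega) (by omega) (by omega)
        · exact JX5 hN (by omega) (by omega) (by omega) (by omega)
    · split_ifs with h
      · obtain ⟨h1, h2⟩ := h
        exact JX2 hN (by omega) (by omega) (by omega) (by omega)
      · unfold PP at h
        by_cases h' : T.b k ≤ T.a i
        · exact JX6 hN (by omega) (by omega) (by omega) (by omega)
        · exact JX3 hN (by omega) (by omega) (by omega) (by omega)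

open Classical in
lemma XX_in {g h : ℤ} (h1 : T.a T.r ≤ g) (h2 : g < h) (h3 : h ≤ T.c T.r) (i : Fin n) :
    XX T g h i = if (T.a i < g ∧ g < T.c i ∧ T.c i < h) ∨ (g < T.a i ∧ T.a i < h ∧ h < T.c i)
      then 1 else 0 := by
  have hN := npos n
  have ro := T.root
  have c1 := T.hab i; have c2 := T.hbc i; have w3 := T.win i
  unfold XX JJ
  have e : (if i = T.r then 0 else Jch (n + 1) (T.a i + (n + 1)) (T.c i + (n + 1))
      (h - 2 * (n + 1) + 1) g (g + 1) h) = 0 := by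
    split_ifs
    · rfl
    · exact JX6 hN (by omega) (by omega) (by omega) (by omega)
  rw [e, add_zero]
  split_ifs with hx
  · rcases hx with hx | hx
    · exact JX1 hN (by omega) (by omega) (by omega) (by omega)
    · exact JX2 hN (by omega) (by omega) (by omega) (by omega)
  · by_cases l1 : T.c i ≤ g
    · exact JX5 hN (by omega) (by omega) (by omega) (by omega)
    by_cases l2 : h ≤ T.a i
    · exact JX6 hN (by omega) (by omega) (by omega) (by omega)
    by_cases l3 : g ≤ T.a i ∧ T.c i ≤ h
    · exact JX3 hN (by omega) (by omega) (by omega) (by omega)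
    · exact JX4 hN (by omega) (by omega) (by omega) (by omega)

lemma arc_type2 {j k : Fin n} (hjk : T.b j < T.b k) : ∃ g h : ℤ, T.a T.r ≤ g ∧ 2 ≤ h - g ∧
    h ≤ T.c T.r ∧ (∀ i, ¬ EE T i g h) ∧ ∀ i, ((T.a i < g ∧ g < T.c i ∧ T.c i < h) ∨
      (g < T.a i ∧ T.a i < h ∧ h < T.c i)) ↔ ¬ (PP T i j ↔ PP T i k) := by
  have hN := npos n
  have w := T.win; have ro := T.root
  have b1 := T.hab j; have b2 := T.hbc j; have b3 := T.hab k; have b4 := T.hbc k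
  have w1 := w j; have w2 := w k
  have hne : j ≠ k := by rintro rfl; omega
  have lm := T.lam j k hne
  have lam' : ∀ i j, i = j ∨ (T.c i ≤ T.a j ∨ T.c j ≤ T.a i ∨ (T.a j ≤ T.a i ∧ T.c i ≤ T.b j) ∨
    (T.b j ≤ T.a i ∧ T.c i ≤ T.c j)
    ∨ (T.a i ≤ T.a j ∧ T.c j ≤ T.b i) ∨ (T.b i ≤ T.a j ∧ T.c j ≤ T.c i)) := fun i j => by
    by_cases h : i = j
    · exact Or.inl h
    · exact Or.inr (T.lam i j h)
  have hcase : T.c j ≤ T.a k ∨ (T.b j ≤ T.a k ∧ T.c k ≤ T.c j) ∨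
      (T.a k ≤ T.a j ∧ T.c j ≤ T.b k) := by omega
  rcases hcase with hc | hc | hc
  · refine ⟨T.b j, T.b k, by omega, by omega, by omega, ?_, ?_⟩
    · intro i hi
      exact EE_nc T (EE_ac T j) hi (by omega) (by omega) (by omega) (by omega)
    · intro i
      unfold PP
      have b5 := T.hab i; have b6 := T.hbc i
      rcases lam' i j with rfl | l1
      · omega
      rcases lam' i k with rfl | l2
      · omega
      omega
  · refine ⟨T.a j, T.b k, by omega, by omega, by omega, ?_, ?_⟩
    · intro i hi
      exact EE_nc T hi (EE_ac T k) (by omega) (by omega) (by omega) (by omega)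
    · intro i
      unfold PP
      have b5 := T.hab i; have b6 := T.hbc i
      rcases lam' i j with rfl | l1
      · omega
      rcases lam' i k with rfl | l2
      · omega
      omega
  · refine ⟨T.b j, T.c k, by omega, by omega, by omega, ?_, ?_⟩
    · intro i hi
      exact EE_nc T (EE_ac T j) hi (by omega) (by omega) (by omega) (by omega)
    · intro i
      unfold PP
      have b5 := T.hab i; have b6 := T.hbc i
      rcases lam' i j with rfl | l1
      · omega
      rcases lam' i k with rfl | l2
      · omega
      omega

open Classical in
lemma XX_type2 {j k : Fin n} (hjk : T.b j < T.b k) : ∃ V ∈ posC (Bm T), V T.r = 0 ∧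
    ∀ i, V i = if PP T i j ↔ PP T i k then 0 else 1 := by
  have ro := T.root
  obtain ⟨g, h, h1, h2, h3, h4, h5⟩ := arc_type2 T hjk
  have key : ∀ i, XX T g h i = if PP T i j ↔ PP T i k then 0 else 1 := by
    intro i
    rw [XX_in T h1 (by omega) h3, ← ite_not]
    exact if_congr (by rw [h5 i]; simp) rfl rfl
  refine ⟨XX T g h, XX_posC T h2 (by omega) h4, ?_, key⟩
  rw [key, if_pos]
  have := T.hab j; have := T.hbc j; have := T.hab k; have := T.hbc k
  have := T.win j; have := T.win k
  unfold PP; omega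

open Classical in
lemma PP_indep {R : Type*} [CommRing R] (w : Fin n → R)
    (hw : ∀ i, ∑ l, (if PP T i l then w l else 0) = 0) : w = 0 := by
  by_contra hne
  obtain ⟨l0, hl0⟩ := Function.ne_iff.1 hne
  obtain ⟨l, hl, hmin⟩ := Finset.exists_min_image (Finset.univ.filter (fun l => w l ≠ 0))
    (fun l => T.c l - T.a l) ⟨l0, by simpa using hl0⟩
  simp only [Finset.mem_filter, Finset.mem_univ, true_and] at hl hmin
  have := hw l
  rw [Finset.sum_eq_single l, if_pos ⟨T.hab l, T.hbc l⟩] at this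
  · exact hl this
  · intro m _ hm
    split_ifs with hp
    · by_contra hwm
      have h1 := hmin m hwm
      have h2 := T.lam l m (Ne.symm hm)
      unfold PP at hp
      have := T.hab l; have := T.hbc l; have := T.hab m; have := T.hbc m
      omega
    · rfl
  · simp

open Classical in
lemma PP_pair {R : Type*} [CommRing R] {j k j' k' : Fin n}
    (h : ∀ i, (if PP T i j then (1:R) else 0) + (if PP T i k then 1 else 0) =
      (if PP T i j' then 1 else 0) + (if PP T i k' then 1 else 0)) (l : Fin n) :
    (if l = j then (1:R) else 0) + (if l = k then 1 else 0) =
      (if l = j' then 1 else 0) + (if l = k' then 1 else 0) := by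
  have := PP_indep T (fun l => (if l = j then (1:R) else 0) + (if l = k then 1 else 0) -
      (if l = j' then 1 else 0) - (if l = k' then 1 else 0)) (fun i => by
    have e : ∀ l, (if PP T i l then (if l = j then (1:R) else 0) + (if l = k then 1 else 0) -
      (if l = j' then 1 else 0) - (if l = k' then 1 else 0) else 0) =
      (if l = j then (if PP T i l then (1:R) else 0) else 0) +
      (if l = k then (if PP T i l then (1:R) else 0) else 0) -
      (if l = j' then (if PP T i l then (1:R) else 0) else 0) -
      (if l = k' then (if PP T i l then (1:R) else 0) else 0) := by
      intro l
      by_cases hp : PP T i l <;> simp [hp]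
    simp only [e, Finset.sum_sub_distrib, Finset.sum_add_distrib, Finset.sum_ite_eq',
      Finset.mem_univ, if_true]
    rw [h i]; ring)
  have := congrFun this l
  simp only [Pi.zero_apply] at this
  linear_combination this

lemma pair_cancel {R : Type*} [CommRing R] [Nontrivial R] {j k k' : Fin n}
    (key : ∀ l : Fin n, (if l = j then (1:R) else 0) + (if l = k then 1 else 0) =
      (if l = j then 1 else 0) + (if l = k' then 1 else 0)) : k = k' := by
  have := add_left_cancel (key k)
  rw [if_pos rfl] at this
  by_contra h
  rw [if_neg h] at this
  exact one_ne_zero this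

lemma pair_eq {R : Type*} [CommRing R] [Nontrivial R] {j k j' k' : Fin n}
    (key : ∀ l : Fin n, (if l = j then (1:R) else 0) + (if l = k then 1 else 0) =
      (if l = j' then 1 else 0) + (if l = k' then 1 else 0))
    (h0 : (1 : R) + 1 ≠ 0 ∨ j ≠ k) : (j = j' ∧ k = k') ∨ (j = k' ∧ k = j') := by
  by_cases h1 : j = j'
  · subst h1; exact Or.inl ⟨rfl, pair_cancel key⟩
  by_cases h2 : j = k'
  · subst h2
    exact Or.inr ⟨rfl, pair_cancel (fun l => (key l).trans (add_comm _ _))⟩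
  exfalso
  have := key j
  rw [if_pos rfl, if_neg h1, if_neg h2, add_zero] at this
  by_cases h3 : j = k
  · rw [if_pos h3] at this
    rcases h0 with h0 | h0
    · exact h0 this
    · exact h0 h3
  · rw [if_neg h3, add_zero] at this
    exact one_ne_zero this

open Classical in
lemma xor_two (p q p' q' : Prop)
    (h : (if p ↔ q then (0:ℤ) else 1) = if p' ↔ q' then 0 else 1) :
    (if p then (1:ZMod 2) else 0) + (if q then 1 else 0) =
      (if p' then 1 else 0) + (if q' then 1 else 0) := by
  have two : (1 : ZMod 2) + 1 = 0 := by decide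
  by_cases e1 : p <;> by_cases e2 : q <;> by_cases e3 : p' <;> by_cases e4 : q' <;>
    simp [e1, e2, e3, e4, two] at h ⊢

lemma lower : n ^ 2 ≤ (posC (Bm T)).ncard := by
  classical
  have ex : ∀ p : Fin n × Fin n, ∃ V ∈ posC (Bm T),
      (T.b p.2 ≤ T.b p.1 → V T.r = 1 ∧ ∀ i, i ≠ T.r →
        V i = (if PP T i p.1 then 1 else 0) + (if PP T i p.2 then 1 else 0)) ∧
      (T.b p.1 < T.b p.2 → V T.r = 0 ∧ ∀ i, V i = if PP T i p.1 ↔ PP T i p.2 then 0 else 1) := by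
    intro p
    by_cases h : T.b p.2 ≤ T.b p.1
    · obtain ⟨V, h1, h2⟩ := XX_type1 T h
      exact ⟨V, h1, fun _ => h2, fun h' => absurd h (by omega)⟩
    · obtain ⟨V, h1, h2⟩ := XX_type2 T (not_le.1 h)
      exact ⟨V, h1, fun h' => absurd h' h, fun _ => h2⟩
  choose V hV h1 h2 using ex
  have hroot : ∀ j, PP T T.r j := fun j => by
    have := T.hab j; have := T.hbc j; have := T.win j; unfold PP; omega
  have inj : Function.Injective V := by
    rintro ⟨j, k⟩ ⟨j', k'⟩ he
    have g1 := h1 (j, k); have g2 := h2 (j, k); have g3 := h1 (j', k'); have g4 := h2 (j', k')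
    simp only at g1 g2 g3 g4
    rw [← he] at g3 g4
    by_cases hl : T.b k ≤ T.b j
    · have g1 := g1 hl
      by_cases hl' : T.b k' ≤ T.b j'
      · have g3 := g3 hl'
        have key := PP_pair (R := ℤ) T (j := j) (k := k) (j' := j') (k' := k') (fun i => by
          by_cases hi : i = T.r
          · subst hi; simp [hroot]
          · rw [← g1.2 i hi, ← g3.2 i hi])
        have := pair_eq key (Or.inl (by norm_num))
        rcases this with ⟨rfl, rfl⟩ | ⟨rfl, rfl⟩
        · rfl
        · have := T.inj_b (le_antisymm hl hl'); subst this; rfl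
      · have := (g4 (not_le.1 hl')).1
        rw [g1.1] at this; exact absurd this one_ne_zero
    · have g2 := g2 (not_le.1 hl)
      by_cases hl' : T.b k' ≤ T.b j'
      · have := (g3 hl').1
        rw [g2.1] at this; exact absurd this.symm one_ne_zero
      · have g4 := g4 (not_le.1 hl')
        have key := PP_pair (R := ZMod 2) T (j := j) (k := k) (j' := j') (k' := k') (fun i =>
          xor_two _ _ _ _ ((g2.2 i).symm.trans (g4.2 i)))
        have hjk : j ≠ k := by rintro rfl; omega
        have := pair_eq key (Or.inr hjk)
        rcases this with ⟨rfl, rfl⟩ | ⟨rfl, rfl⟩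
        · rfl
        · omega
  have hfin := (upper T).1
  have hsub : Set.range V ⊆ posC (Bm T) := by rintro _ ⟨p, rfl⟩; exact hV p
  have := Set.ncard_le_ncard hsub hfin
  rw [← Set.image_univ, Set.ncard_image_of_injective _ inj, Set.ncard_univ] at this
  simpa [sq] using this

end


section
variable {n : ℕ}

/-- skew-symmetrizability with a given symmetrizer -/
def SSd (d : Fin n → ℤ) (B : Matrix (Fin n) (Fin n) ℤ) : Prop :=
  ∀ i j, d i * B i j = -(d j * B j i)

lemma SSd_of {B : Matrix (Fin n) (Fin n) ℤ} (h : SkewSymmetrizable B) :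
    ∃ d : Fin n → ℤ, (∀ i, 0 < d i) ∧ SSd d B := by
  obtain ⟨d, h1, h2⟩ := h
  refine ⟨d, h1, fun i j => ?_⟩
  have := congrFun (congrFun h2 j) i
  simpa [Matrix.diagonal_mul] using this

lemma SSd_neg {d : Fin n → ℤ} (hd : ∀ i, 0 < d i) {B : Matrix (Fin n) (Fin n) ℤ}
    (h : SSd d B) (i j : Fin n) : (0 < B i j ↔ B j i < 0) := by
  have := h i j; have h1 := hd i; have h2 := hd j
  constructor
  · intro h3
    have := mul_pos h1 h3
    by_contra hh
    have := mul_nonneg h2.le (not_lt.1 hh)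
    linarith
  · intro h3
    have := mul_neg_of_pos_of_neg h2 h3
    by_contra hh
    have := mul_nonpos_of_nonneg_of_nonpos h1.le (not_lt.1 hh)
    linarith

lemma SSd_mut {d : Fin n → ℤ} (hd : ∀ i, 0 < d i) {B : Matrix (Fin n) (Fin n) ℤ}
    (h : SSd d B) (k : Fin n) : SSd d (mutMat k B) := by
  intro i j
  unfold mutMat
  have hij := h i j
  by_cases hc : i = k ∨ j = k
  · rw [if_pos hc, if_pos hc.symm]; linarith
  rw [if_neg hc, if_neg (fun h => hc h.symm)]
  have s1 := SSd_neg hd h i k; have s2 := SSd_neg hd h k i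
  have s3 := SSd_neg hd h j k; have s4 := SSd_neg hd h k j
  have e1 := h i k; have e2 := h j k
  suffices hs : d i * ((B i k).sign * max (B i k * B k j) 0) =
      -(d j * ((B j k).sign * max (B j k * B k i) 0)) by linarith
  rcases lt_trichotomy (B i k) 0 with hi | hi | hi
  · have hi' := s2.2 hi
    rcases lt_trichotomy (B j k) 0 with hj | hj | hj
    · have hj' := s4.2 hj
      rw [max_eq_right (mul_nonpos_of_nonpos_of_nonneg hi.le hj'.le),
        max_eq_right (mul_nonpos_of_nonpos_of_nonneg hj.le hi'.le)]; ring
    · have hj' : B k j = 0 := by omega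
      rw [hj, hj']; simp
    · have hj' := s3.1 hj
      rw [max_eq_left (mul_nonneg_of_nonpos_of_nonpos hi.le hj'.le),
        max_eq_left (mul_nonneg hj.le hi'.le), Int.sign_eq_neg_one_of_neg hi,
        Int.sign_eq_one_of_pos hj]
      linear_combination (-B k j) * e1 + B k i * e2
  · have hi' : B k i = 0 := by omega
    rw [hi, hi']; simp
  · have hi' := s1.1 hi
    rcases lt_trichotomy (B j k) 0 with hj | hj | hj
    · have hj' := s4.2 hj
      rw [max_eq_left (mul_nonneg hi.le hj'.le),
        max_eq_left (mul_nonneg_of_nonpos_of_nonpos hj.le hi'.le), Int.sign_eq_neg_one_of_neg hj,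
        Int.sign_eq_one_of_pos hi]
      linear_combination (B k j) * e1 - B k i * e2
    · have hj' : B k j = 0 := by omega
      rw [hj, hj']; simp
    · have hj' := s3.1 hj
      rw [max_eq_right (mul_nonpos_of_nonneg_of_nonpos hi.le hj'.le),
        max_eq_right (mul_nonpos_of_nonneg_of_nonpos hj.le hi'.le)]; ring

/-- left end points of a zigzag -/
def zA (s : ℕ → Bool) : ℕ → ℤ
  | 0 => 0
  | k + 1 => zA s k + if s (k + 1) = true then 1 else 0

lemma zA_mono (s : ℕ → Bool) {p q : ℕ} (h : p ≤ q) :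
    zA s p ≤ zA s q ∧ zA s q - q ≤ zA s p - p := by
  induction q, h using Nat.le_induction with
  | base => simp
  | succ q h ih =>
    simp only [zA]
    push_cast
    split_ifs <;> omega

/-- splitting points of a zigzag -/
def zB (n : ℕ) (s : ℕ → Bool) (k : ℕ) : ℤ :=
  if s (k + 1) = true then zA s k + 1 else zA s k + n - k

lemma zigzag (hn : 0 < n) (e : Fin n ≃ Fin n) (s : ℕ → Bool) : ∃ T : Tri n,
    (e T.r : ℕ) = 0 ∧ (∀ j, j ≠ T.r → (e (T.par j) : ℕ) + 1 = e j) ∧ ∀ j, T.side j = s (e j) := by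
  have er : ∀ j, j ≠ e.symm ⟨0, hn⟩ → 0 < (e j : ℕ) := by
    intro j hj
    by_contra hh
    apply hj
    rw [Equiv.eq_symm_apply]
    exact Fin.ext (by simp; omega)
  have lam0 : ∀ p q : ℕ, p < q → q < n →
      (zA s p ≤ zA s q ∧ zA s q + (n + 1) - q ≤ zB n s p) ∨
      (zB n s p ≤ zA s q ∧ zA s q + (n + 1) - q ≤ zA s p + (n + 1) - p) := by
    intro p q hpq hq
    have h1 := zA_mono s (Nat.succ_le_of_lt hpq)
    have h2 : zA s (p + 1) = zA s p + if s (p + 1) = true then 1 else 0 := rfl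
    simp only [Nat.succ_eq_add_one] at h1
    push_cast at h1
    unfold zB
    split_ifs at h2 ⊢ with hs
    · right; omega
    · left; omega
  refine ⟨⟨e.symm ⟨0, hn⟩, fun j => e.symm ⟨(e j : ℕ) - 1, by omega⟩, fun j => s (e j),
    fun j => zA s (e j), fun j => zB n s (e j), fun j => zA s (e j) + (n + 1) - (e j : ℕ),
    ?_, ?_, ?_, ?_, ?_, ?_, ?_⟩, ?_, ?_, ?_⟩
  · intro j
    have := (e j).isLt
    simp only [zB]; split_ifs <;> omega
  · intro j
    have := (e j).isLt
    simp only [zB]; split_ifs <;> omega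
  · intro j
    have := zA_mono s (Nat.zero_le (e j))
    simp; omega
  · simp
  · intro j hj hs
    obtain ⟨m, hm⟩ : ∃ m, (e j : ℕ) = m + 1 := ⟨(e j : ℕ) - 1, by have := er j hj; omega⟩
    simp only [hm, Equiv.apply_symm_apply, Nat.add_sub_cancel] at hs ⊢
    simp only [zA, zB, hs]
    push_cast
    simp; ring
  · intro j hj hs
    obtain ⟨m, hm⟩ : ∃ m, (e j : ℕ) = m + 1 := ⟨(e j : ℕ) - 1, by have := er j hj; omega⟩
    simp only [hm, Equiv.apply_symm_apply, Nat.add_sub_cancel] at hs ⊢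
    simp only [zA, zB, hs]
    push_cast
    simp; ring
  · intro i j hij
    have hne : (e i : ℕ) ≠ e j := fun h => hij (e.injective (Fin.ext h))
    rcases lt_or_gt_of_ne hne with h | h
    · have := lam0 _ _ h (e j).isLt; tauto
    · have := lam0 _ _ h (e i).isLt; tauto
  · simp
  · intro j hj
    have := er j hj
    simp; omega
  · intro j; rfl

lemma typeC_zigzag (hn : 0 < n) {B : Matrix (Fin n) (Fin n) ℤ} {d : Fin n → ℤ}
    (hd : ∀ i, 0 < d i) (hB : SSd d B) (σ : Equiv.Perm (Fin n))
    (hσ : ∀ i j, cartanCounterpart B (σ i) (σ j) = cartanC n i j) : ∃ T : Tri n, Bm T = B := by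
  classical
  let e : Fin n ≃ Fin n := σ.symm.trans Fin.revPerm
  let s : ℕ → Bool := fun k => decide (∃ i j, (e i : ℕ) = k ∧ (e j : ℕ) + 1 = k ∧ 0 < B i j)
  have hs : ∀ i j, (e j : ℕ) + 1 = e i → (s (e i) = true ↔ 0 < B i j) := by
    intro i j hij
    simp only [s, decide_eq_true_eq]
    constructor
    · rintro ⟨i', j', h1, h2, h3⟩
      have : i' = i := e.injective (Fin.ext h1)
      have : j' = j := e.injective (Fin.ext (by omega))
      subst i' j'; exact h3
    · intro h; exact ⟨i, j, rfl, hij, h⟩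
  have he : ∀ i, (e i : ℕ) + (σ.symm i : ℕ) + 1 = n := by
    intro i
    simp only [e, Equiv.trans_apply, Fin.revPerm_apply, Fin.val_rev]
    omega
  have habs : ∀ i j, i ≠ j → |B i j| = if (e i : ℕ) = 1 ∧ (e j : ℕ) = 0 then 2 else
      if (e j : ℕ) + 1 = e i ∨ (e i : ℕ) + 1 = e j then 1 else 0 := by
    intro i j hij
    have h := hσ (σ.symm i) (σ.symm j)
    have h1 := he i; have h2 := he j
    have hij' : σ.symm i ≠ σ.symm j := fun h => hij (σ.symm.injective h)
    simp only [Equiv.apply_symm_apply, cartanCounterpart, cartanC, if_neg hij, if_neg hij'] at h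
    split_ifs at h ⊢ <;> omega
  have hdiag : ∀ i, B i i = 0 := by
    intro i
    have := hB i i; have := hd i
    have : d i * B i i = 0 := by linarith
    rcases mul_eq_zero.1 this with h | h
    · omega
    · exact h
  obtain ⟨T, t1, t2, t3⟩ := zigzag hn e s
  refine ⟨T, ?_⟩
  have hr0 : ∀ j, j = T.r ↔ (e j : ℕ) = 0 := by
    intro j
    constructor
    · rintro rfl; exact t1
    · intro h; exact e.injective (Fin.ext (by omega))
  have hpar : ∀ i j, (i ≠ T.r ∧ T.par i = j) ↔ (e j : ℕ) + 1 = e i := by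
    intro i j
    constructor
    · rintro ⟨h1, rfl⟩; exact t2 i h1
    · intro h
      have h1 : i ≠ T.r := by rw [Ne, hr0]; omega
      exact ⟨h1, e.injective (Fin.ext (by have := t2 i h1; omega))⟩
  funext i j
  unfold Bm
  by_cases c1 : (e j : ℕ) + 1 = e i
  · rw [if_pos ((hpar i j).2 c1), t3]
    have hij : i ≠ j := by rintro rfl; omega
    have ha := habs i j hij
    have hsi := hs i j c1
    have hx : ((e i : ℕ) = 1 ∧ (e j : ℕ) = 0) ↔ j = T.r := by rw [hr0]; omega
    rw [if_congr hx rfl rfl, if_pos (Or.inl c1)] at ha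
    by_cases hp : 0 < B i j
    · rw [if_pos (hsi.2 hp), one_mul, ← ha, abs_of_pos hp]
    · rw [if_neg (fun h => hp (hsi.1 h)), ← ha, abs_of_nonpos (not_lt.1 hp)]; ring
  rw [if_neg (fun h => c1 ((hpar i j).1 h))]
  by_cases c2 : (e i : ℕ) + 1 = e j
  · rw [if_pos ((hpar j i).2 c2), t3]
    have hij : i ≠ j := by rintro rfl; omega
    have ha := habs i j hij
    have hsi := hs j i c2
    rw [if_neg (by omega), if_pos (Or.inr c2)] at ha
    have hn1 := SSd_neg hd hB j i
    by_cases hp : B i j < 0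
    · rw [if_pos (hsi.2 (hn1.2 hp))]
      rw [abs_of_neg hp] at ha; omega
    · rw [if_neg (fun h => hp (hn1.1 (hsi.1 h)))]
      rw [abs_of_nonneg (not_lt.1 hp)] at ha; omega
  rw [if_neg (fun h => c2 ((hpar j i).1 h)), if_neg]
  · by_cases hij : i = j
    · rw [hij, hdiag]
    · have ha := habs i j hij
      rw [if_neg (by omega), if_neg (by omega)] at ha
      exact (abs_eq_zero.1 ha).symm
  · rintro ⟨h1, h2, h3, h4⟩
    have := t2 i h1; have := t2 j h2
    rw [h4] at *
    exact h3 (e.injective (Fin.ext (by omega)))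

lemma mut_Bm (T : Tri n) (k : Fin n) : ∃ T', Bm T' = mutMat k (Bm T) := by
  by_cases hr : k = T.r
  · obtain ⟨T', h⟩ := RootF_exists T
    exact ⟨T', by rw [hr]; exact RootF_B h⟩
  · cases hs : T.side k
    · obtain ⟨T', h⟩ := LF_exists T k hr hs
      exact ⟨T', LF_B h⟩
    · obtain ⟨T', h⟩ := RF_exists T k hr hs
      exact ⟨T', by rw [LF_B h, mutMat_invol]⟩

lemma typeC_Bm (hn : 0 < n) {B : Matrix (Fin n) (Fin n) ℤ} (hB : SkewSymmetrizable B)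
    (hC : MatrixOfTypeC B) : ∃ T : Tri n, Bm T = B := by
  obtain ⟨d, hd, hS⟩ := SSd_of hB
  obtain ⟨B', hmut, σ, hσ⟩ := hC
  have key : ∀ C, Relation.ReflTransGen (fun a c => ∃ k, c = mutMat k a) B C →
      SSd d C ∧ ((∃ T : Tri n, Bm T = C) → ∃ T : Tri n, Bm T = B) := by
    intro C hmut
    induction hmut with
    | refl => exact ⟨hS, id⟩
    | tail h1 h2 ih =>
      obtain ⟨k, rfl⟩ := h2
      refine ⟨SSd_mut hd ih.1 k, ?_⟩
      rintro ⟨T, hT⟩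
      obtain ⟨T', hT'⟩ := mut_Bm T k
      exact ih.2 ⟨T', by rw [hT', hT, mutMat_invol]⟩
  have := key B' hmut
  exact this.2 (typeC_zigzag hn hd this.1 σ hσ)

end

lemma main_aux {n : ℕ} (hn : 2 ≤ n)
    (B : Matrix (Fin n) (Fin n) ℤ) (hB : SkewSymmetrizable B)
    (htype : MatrixOfTypeC B) :
    {c : Fin n → ℤ | IsCVec B c} =
        {c | IsCVec B c ∧ c ≠ 0 ∧ ∀ i, 0 ≤ c i} ∪
          (fun c => -c) '' {c | IsCVec B c ∧ c ≠ 0 ∧ ∀ i, 0 ≤ c i} ∧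
      (0 : Fin n → ℤ) ∉ {c : Fin n → ℤ | IsCVec B c} ∧
      {c : Fin n → ℤ | IsCVec B c ∧ c ≠ 0 ∧ ∀ i, 0 ≤ c i}.ncard = n ^ 2 := by
  obtain ⟨T, rfl⟩ := typeC_Bm (by omega) hB htype
  refine ⟨?_, ?_, le_antisymm (upper T).2 (lower T)⟩
  · ext c
    constructor
    · intro hc
      obtain ⟨h1, h2, -⟩ := CVec_tri T hc
      rcases h2 with h2 | h2
      · exact Or.inl ⟨hc, h1, h2⟩
      · refine Or.inr ⟨-c, ⟨CVec_neg hc, neg_ne_zero.2 h1, fun i => ?_⟩, neg_neg c⟩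
        have := h2 i
        simpa using this
    · rintro (h | ⟨c, h, rfl⟩)
      · exact h.1
      · exact CVec_neg h.1
  · intro h
    exact (CVec_tri T h).1 rfl


/-- For a cluster algebra with principal coefficients of type `C_n` (`n ≥ 2`),
the set of `c`-vectors is the union of the positive `c`-vectors and their
negatives (in particular `0` is not a `c`-vector), and there are exactly `n²`
positive `c`-vectors. -/
theorem c_vectors_positive_union_type_C {n : ℕ} (hn : 2 ≤ n)
    (B : Matrix (Fin n) (Fin n) ℤ) (hB : SkewSymmetrizable B)
    (htype : MatrixOfTypeC B) :
    {c : Fin n → ℤ | IsCVec B c} =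
        {c | IsCVec B c ∧ c ≠ 0 ∧ ∀ i, 0 ≤ c i} ∪
          (fun c => -c) '' {c | IsCVec B c ∧ c ≠ 0 ∧ ∀ i, 0 ≤ c i} ∧
      (0 : Fin n → ℤ) ∉ {c : Fin n → ℤ | IsCVec B c} ∧
      {c : Fin n → ℤ | IsCVec B c ∧ c ≠ 0 ∧ ∀ i, 0 ≤ c i}.ncard = n ^ 2 := by
  exact main_aux hn B hB htype
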